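/- arXiv:1206.3926 — 2 statements merged into one kernel-verified Lean document; each statement's English description precedes it below -/
import Mathlib

section
/- (Symmetry hyperplane with nonnegative principal eigenvalue implies foliated Schwarz symmetry.) Let Ω be an open ball or annulus centered at the origin in ℝ^N, N ≥ 2, and let U ∈ C²(Ω̄;ℝ^m) be a classical solution of −Δu_i = f_i(|x|,U) in Ω, u_i = 0 on ∂Ω, such that the system is fully coupled along U in Ω(e') for every e' ∈ S^{N−1}. Suppose there exists a direction e ∈ S^{N−1} such that U = U^{σ_e} (U is symmetric with respect to the hyperplane T(e)) and the principal eigenvalue of the linearized operator L_U V = −ΔV − J_F(|x|,U(x))V in Ω(e) is nonnegative, in the sense that there exists Ψ ∈ C²(Ω(e);ℝ^m) with Ψ > 0 in Ω(e) (componentwise) and −ΔΨ − J_F(|x|,U(x))Ψ ≥ 0 in Ω(e). Then U is foliated Schwarz symmetric. -/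
open MeasureTheory Real Set
open scoped RealInnerProductSpace ENNReal

noncomputable section

/-- Euclidean space `ℝ^N`. -/
abbrev EuclN (N : ℕ) := EuclideanSpace ℝ (Fin N)

/-- The Laplacian of a scalar function on `ℝ^N`. -/
def lap {N : ℕ} (u : EuclN N → ℝ) (x : EuclN N) : ℝ :=
  ∑ i : Fin N, iteratedFDeriv ℝ 2 u x ![EuclideanSpace.single i 1, EuclideanSpace.single i 1]

/-- Partial derivative `∂f/∂u_j` of `f(r, u)` with respect to the `j`-th `u`-variable. -/
def pd {m : ℕ} (f : ℝ → (Fin m → ℝ) → ℝ) (j : Fin m) (r : ℝ) (s : Fin m → ℝ) : ℝ :=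
  fderiv ℝ (f r) s (Pi.single j 1)

/-- `Ψ ∈ C^1_c(Ω'; ℝ^m)`. -/
def IsTestFun {N m : ℕ} (Ω' : Set (EuclN N)) (Ψ : Fin m → EuclN N → ℝ) : Prop :=
  ∀ i, ContDiff ℝ 1 (Ψ i) ∧ HasCompactSupport (Ψ i) ∧ tsupport (Ψ i) ⊆ Ω'

/-- The quadratic form `Q_U(Ψ; Ω')` of the linearized operator at a solution `U`. -/
def Qform {N m : ℕ} (f : Fin m → ℝ → (Fin m → ℝ) → ℝ) (U : Fin m → EuclN N → ℝ)
    (Ω' : Set (EuclN N)) (Ψ : Fin m → EuclN N → ℝ) : ℝ :=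
  ∫ x in Ω', ((∑ i, ‖gradient (Ψ i) x‖ ^ 2) -
    ∑ i, ∑ j, pd (f i) j ‖x‖ (fun k => U k x) * Ψ i x * Ψ j x)

/-- There is a `k`-dimensional subspace of `C^1_c(Ω'; ℝ^m)` on which `Q_U(·; Ω')`
is negative definite. -/
def NegDefFamily {N m : ℕ} (f : Fin m → ℝ → (Fin m → ℝ) → ℝ) (U : Fin m → EuclN N → ℝ)
    (Ω' : Set (EuclN N)) (k : ℕ) : Prop :=
  ∃ Ψ : Fin k → Fin m → EuclN N → ℝ,
    (∀ l, IsTestFun Ω' (Ψ l)) ∧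
    ∀ c : Fin k → ℝ, c ≠ 0 → Qform f U Ω' (fun i x => ∑ l, c l * Ψ l i x) < 0

/-- The semilinear system is cooperative (weakly coupled) in `Ω'`. -/
def CoopAlong {N m : ℕ} (f : Fin m → ℝ → (Fin m → ℝ) → ℝ) (Ω' : Set (EuclN N)) : Prop :=
  ∀ i j, i ≠ j → ∀ x ∈ Ω', ∀ s : Fin m → ℝ, 0 ≤ pd (f i) j ‖x‖ s

/-- The semilinear system is fully coupled along the solution `U` in `Ω'`. -/
def FullyCoupledAlong {N m : ℕ} (f : Fin m → ℝ → (Fin m → ℝ) → ℝ)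
    (U : Fin m → EuclN N → ℝ) (Ω' : Set (EuclN N)) : Prop :=
  CoopAlong f Ω' ∧
  ∀ I J : Finset (Fin m), I.Nonempty → J.Nonempty → Disjoint I J → I ∪ J = Finset.univ →
    ∃ i₀ ∈ I, ∃ j₀ ∈ J,
      0 < volume {x ∈ Ω' | 0 < pd (f i₀) j₀ ‖x‖ (fun k => U k x)}

/-- `Ω` is an open ball or annulus centered at the origin. -/
def IsBallOrAnnulus {N : ℕ} (Ω : Set (EuclN N)) : Prop :=
  (∃ R : ℝ, 0 < R ∧ Ω = Metric.ball (0 : EuclN N) R) ∨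
  (∃ r R : ℝ, 0 < r ∧ r < R ∧ Ω = {x : EuclN N | r < ‖x‖ ∧ ‖x‖ < R})

/-- The half-domain `Ω(e) = {x ∈ Ω : x·e > 0}`. -/
def halfDom {N : ℕ} (Ω : Set (EuclN N)) (e : EuclN N) : Set (EuclN N) :=
  {x ∈ Ω | 0 < ⟪x, e⟫}

/-- Reflection through the hyperplane `T(e) = {x : x·e = 0}`. -/
def reflPt {N : ℕ} (e x : EuclN N) : EuclN N := x - (2 * ⟪x, e⟫) • e

/-- `U` is foliated Schwarz symmetric on `Ω` with respect to the axis `p`. -/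
def FoliatedSchwarzWith {N m : ℕ} (Ω : Set (EuclN N)) (U : Fin m → EuclN N → ℝ)
    (p : EuclN N) : Prop :=
  ‖p‖ = 1 ∧ ∀ i, ∀ x ∈ Ω, ∀ y ∈ Ω, ‖x‖ = ‖y‖ → ⟪y, p⟫ ≤ ⟪x, p⟫ → U i y ≤ U i x

/-- `U` is foliated Schwarz symmetric on `Ω`. -/
def FoliatedSchwarz {N m : ℕ} (Ω : Set (EuclN N)) (U : Fin m → EuclN N → ℝ) : Prop :=
  ∃ p : EuclN N, FoliatedSchwarzWith Ω U p

/-- `U` is radial on `Ω`. -/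
def IsRadial {N m : ℕ} (Ω : Set (EuclN N)) (U : Fin m → EuclN N → ℝ) : Prop :=
  ∀ i, ∀ x ∈ Ω, ∀ y ∈ Ω, ‖x‖ = ‖y‖ → U i x = U i y

/-- `U` is a classical solution of `-Δu_i = f_i(|x|, U)` in `Ω`, `u_i = 0` on `∂Ω`. -/
def IsSolution {N m : ℕ} (Ω : Set (EuclN N)) (f : Fin m → ℝ → (Fin m → ℝ) → ℝ)
    (U : Fin m → EuclN N → ℝ) : Prop :=
  (∀ i, ∀ x ∈ Ω, -lap (U i) x = f i ‖x‖ (fun k => U k x)) ∧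
  (∀ i, ∀ x ∈ frontier Ω, U i x = 0)

/-- The bilinear form of the linear system `-ΔU + C(x) U`. -/
def BformL {N m : ℕ} (Ω' : Set (EuclN N)) (C : Fin m → Fin m → EuclN N → ℝ)
    (V Φ : Fin m → EuclN N → ℝ) : ℝ :=
  ∫ x in Ω', ((∑ i, ⟪gradient (V i) x, gradient (Φ i) x⟫) +
    ∑ i, ∑ j, C i j x * V i x * Φ j x)

/-- `-ΔU + D U ≥ 0` weakly in `Ω'`. -/
def WeakSuperSol {N m : ℕ} (Ω' : Set (EuclN N)) (D : Fin m → Fin m → EuclN N → ℝ)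
    (U : Fin m → EuclN N → ℝ) : Prop :=
  ∀ Ψ : Fin m → EuclN N → ℝ, IsTestFun Ω' Ψ → (∀ i x, 0 ≤ Ψ i x) →
    0 ≤ BformL Ω' D U Ψ

/-- `-ΔU + D U ≤ 0` weakly in `Ω'`. -/
def WeakSubSol {N m : ℕ} (Ω' : Set (EuclN N)) (D : Fin m → Fin m → EuclN N → ℝ)
    (U : Fin m → EuclN N → ℝ) : Prop :=
  ∀ Ψ : Fin m → EuclN N → ℝ, IsTestFun Ω' Ψ → (∀ i x, 0 ≤ Ψ i x) →
    BformL Ω' D U Ψ ≤ 0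

/-- The linear system with matrix `D` is cooperative in `Ω`: `d_ij ≤ 0` a.e. for `i ≠ j`. -/
def LinCoop {N m : ℕ} (Ω : Set (EuclN N)) (D : Fin m → Fin m → EuclN N → ℝ) : Prop :=
  ∀ i j, i ≠ j → ∀ᵐ x ∂(volume : Measure (EuclN N)), x ∈ Ω → D i j x ≤ 0

/-- The linear system with matrix `D` is fully coupled in `Ω`. -/
def LinFullyCoupled {N m : ℕ} (Ω : Set (EuclN N)) (D : Fin m → Fin m → EuclN N → ℝ) : Prop :=
  LinCoop Ω D ∧
  ∀ I J : Finset (Fin m), I.Nonempty → J.Nonempty → Disjoint I J → I ∪ J = Finset.univ →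
    ∃ i₀ ∈ I, ∃ j₀ ∈ J, 0 < volume {x ∈ Ω | D i₀ j₀ x < 0}

/-- First symmetric eigenvalue on `Ω'`: the infimum of the Rayleigh quotient of the
symmetric matrix `C` over nontrivial test functions. -/
def lamOneSym {N m : ℕ} (Ω' : Set (EuclN N)) (C : Fin m → Fin m → EuclN N → ℝ) : ℝ :=
  sInf {r : ℝ | ∃ Ψ : Fin m → EuclN N → ℝ, IsTestFun Ω' Ψ ∧ (∃ i x, Ψ i x ≠ 0) ∧
    r = BformL Ω' C Ψ Ψ / ∫ x in Ω', ∑ i, (Ψ i x) ^ 2}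

end

section

open Filter Topology



lemma lap_eq_laplacian {N : ℕ} (u : EuclN N → ℝ) (x : EuclN N) :
    lap u x = (Laplacian.laplacian u : EuclN N → ℝ) x := by
  rw [InnerProductSpace.laplacian_eq_iteratedFDeriv_orthonormalBasis u (EuclideanSpace.basisFun (Fin N) ℝ)]
  simp [lap]

lemma lap_eq_basis {N : ℕ} (u : EuclN N → ℝ) (x : EuclN N)
    (b : OrthonormalBasis (Fin N) ℝ (EuclN N)) :
    lap u x = ∑ i, iteratedFDeriv ℝ 2 u x ![b i, b i] := by
  rw [lap_eq_laplacian, InnerProductSpace.laplacian_eq_iteratedFDeriv_orthonormalBasis u b]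

lemma lap_add {N : ℕ} {u v : EuclN N → ℝ} {x : EuclN N} (hu : ContDiffAt ℝ 2 u x)
    (hv : ContDiffAt ℝ 2 v x) : lap (fun y => u y + v y) x = lap u x + lap v x := by
  simp only [lap_eq_laplacian]
  exact hu.laplacian_add hv

lemma lap_sub {N : ℕ} {u v : EuclN N → ℝ} {x : EuclN N} (hu : ContDiffAt ℝ 2 u x)
    (hv : ContDiffAt ℝ 2 v x) : lap (fun y => u y - v y) x = lap u x - lap v x := by
  simp only [lap_eq_laplacian]
  exact hu.laplacian_sub hv

lemma lap_smul {N : ℕ} {u : EuclN N → ℝ} {x : EuclN N} (c : ℝ) (hu : ContDiffAt ℝ 2 u x) :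
    lap (fun y => c * u y) x = c * lap u x := by
  simp only [lap_eq_laplacian]
  exact InnerProductSpace.laplacian_smul c hu

lemma second_deriv_line {N : ℕ} {u : EuclN N → ℝ} {x : EuclN N} (hu : ContDiffAt ℝ 2 u x)
    (v : EuclN N) :
    deriv (deriv (fun t : ℝ => u (x + t • v))) 0 = iteratedFDeriv ℝ 2 u x ![v, v] := by
  have hline : ∀ t : ℝ, HasDerivAt (fun t : ℝ => x + t • v) v t := fun t => by
    simpa using ((hasDerivAt_id t).smul_const v).const_add x
  have hev : ∀ᶠ y in 𝓝 x, DifferentiableAt ℝ u y := by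
    have := hu.eventually (by simp)
    filter_upwards [this] with y hy using hy.differentiableAt (by simp)
  have hcont : Tendsto (fun t : ℝ => x + t • v) (𝓝 0) (𝓝 x) := by
    have := (hline 0).continuousAt.tendsto
    simpa using this
  have h1 : deriv (fun t : ℝ => u (x + t • v)) =ᶠ[𝓝 0] fun t => fderiv ℝ u (x + t • v) v := by
    filter_upwards [hcont.eventually hev] with t ht
    exact (ht.hasFDerivAt.comp_hasDerivAt t (hline t)).deriv
  rw [h1.deriv_eq]
  have h2 : DifferentiableAt ℝ (fderiv ℝ u) x :=
    (hu.fderiv_right (m := 1) (by norm_num)).differentiableAt (by simp)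
  have h3 : HasDerivAt (fun t : ℝ => fderiv ℝ u (x + t • v)) (fderiv ℝ (fderiv ℝ u) x v) 0 := by
    have h2' : HasFDerivAt (fderiv ℝ u) (fderiv ℝ (fderiv ℝ u) x) (x + (0:ℝ) • v) := by
      simpa using h2.hasFDerivAt
    exact h2'.comp_hasDerivAt (0:ℝ) (hline 0)
  have h4 : HasDerivAt (fun t : ℝ => fderiv ℝ u (x + t • v) v) (fderiv ℝ (fderiv ℝ u) x v v) 0 := by
    simpa using h3.clm_apply (hasDerivAt_const (0:ℝ) v)
  rw [h4.deriv, iteratedFDeriv_two_apply]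
  simp

lemma deriv2_nonpos_of_localMax {g : ℝ → ℝ} (hc : ContinuousAt g 0) (h : IsLocalMax g 0) :
    deriv (deriv g) 0 ≤ 0 := by
  by_contra hpos
  push Not at hpos
  have hmin := isLocalMin_of_deriv_deriv_pos hpos h.deriv_eq_zero hc
  have heq : g =ᶠ[𝓝 0] fun _ => g 0 := by
    filter_upwards [h, hmin] with t h1 h2 using le_antisymm h1 h2
  have h1 : deriv g =ᶠ[𝓝 0] fun _ => 0 := by
    have := heq.deriv
    simpa using this
  have := h1.deriv_eq
  simp at this
  linarith

lemma lap_nonpos_of_localMax {N : ℕ} {u : EuclN N → ℝ} {x : EuclN N} (hu : ContDiffAt ℝ 2 u x)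
    (h : IsLocalMax u x) : lap u x ≤ 0 := by
  unfold lap
  refine Finset.sum_nonpos fun i _ => ?_
  rw [← second_deriv_line hu]
  have hcont : ContinuousAt (fun t : ℝ => x + t • (EuclideanSpace.single i (1:ℝ) : EuclN N)) 0 := by
    fun_prop
  apply deriv2_nonpos_of_localMax
  · apply ContinuousAt.comp (g := u)
    · simpa using hu.continuousAt
    · exact hcont
  · have : Tendsto (fun t : ℝ => x + t • (EuclideanSpace.single i (1:ℝ) : EuclN N)) (𝓝 0) (𝓝 x) := by
      simpa using hcont.tendsto
    have h2 := this.eventually h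
    simp only [IsLocalMax, IsMaxFilter]
    simpa using h2

lemma lap_continuousAt {N : ℕ} {u : EuclN N → ℝ} {x : EuclN N} (hu : ContDiffAt ℝ 2 u x) :
    ContinuousAt (lap u) x := by
  have h2 : ContinuousAt (fderiv ℝ (fderiv ℝ u)) x :=
    ((hu.fderiv_right (m := 1) (by norm_num)).fderiv_right (m := 0) (by norm_num)).continuousAt
  have : lap u = fun y => ∑ i : Fin N, fderiv ℝ (fderiv ℝ u) y (EuclideanSpace.single i 1) (EuclideanSpace.single i 1) := by
    ext y
    simp [lap, iteratedFDeriv_two_apply]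
  rw [this]
  fun_prop

lemma lap_isometry {N : ℕ} (L : EuclN N ≃ₗᵢ[ℝ] EuclN N) {u : EuclN N → ℝ} {x : EuclN N}
    (hu : ContDiffAt ℝ 2 u (L x)) : lap (fun y => u (L y)) x = lap u (L x) := by
  rw [lap_eq_basis u (L x) ((EuclideanSpace.basisFun (Fin N) ℝ).map L),
    lap_eq_basis _ x (EuclideanSpace.basisFun (Fin N) ℝ)]
  refine Finset.sum_congr rfl fun i _ => ?_
  rw [← second_deriv_line hu, ← second_deriv_line]
  · simp
  · exact ContDiffAt.comp x hu L.contDiff.contDiffAt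

/-- Laplacian of `F ∘ d` for `d` quadratic with isotropic second derivative. -/
lemma lap_comp_quad {N : ℕ} {F F1 : ℝ → ℝ} {F2 : ℝ} {d : EuclN N → ℝ} {x : EuclN N}
    (b : Fin N → ℝ) (c : ℝ)
    (hd : ∀ (i : Fin N) (t : ℝ), d (x + t • (EuclideanSpace.single i (1:ℝ) : EuclN N)) =
      d x + b i * t + c * t ^ 2)
    (hF : ∀ᶠ s in 𝓝 (d x), HasDerivAt F (F1 s) s)
    (hF1 : HasDerivAt F1 F2 (d x))
    (hu : ContDiffAt ℝ 2 (fun y => F (d y)) x) :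
    lap (fun y => F (d y)) x = F2 * (∑ i, b i ^ 2) + 2 * N * c * F1 (d x) := by
  have key : ∀ i : Fin N, iteratedFDeriv ℝ 2 (fun y => F (d y)) x
      ![EuclideanSpace.single i 1, EuclideanSpace.single i 1] = F2 * b i ^ 2 + 2 * c * F1 (d x) := by
    intro i
    rw [← second_deriv_line hu]
    simp only [hd]
    have hp : ∀ t : ℝ, HasDerivAt (fun t : ℝ => d x + b i * t + c * t ^ 2) (b i + 2 * c * t) t := by
      intro t
      have := ((hasDerivAt_id t).const_mul (b i)).const_add (d x) |>.add
        ((hasDerivAt_pow 2 t).const_mul c)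
      exact this.congr_deriv (by simp; ring)
    have hq : Tendsto (fun t : ℝ => d x + b i * t + c * t ^ 2) (𝓝 0) (𝓝 (d x)) := by
      have := (hp 0).continuousAt.tendsto
      simpa using this
    have h1 : deriv (fun t : ℝ => F (d x + b i * t + c * t ^ 2)) =ᶠ[𝓝 0]
        fun t => F1 (d x + b i * t + c * t ^ 2) * (b i + 2 * c * t) := by
      filter_upwards [hq.eventually hF] with t ht
      exact (ht.comp t (hp t)).deriv
    rw [h1.deriv_eq]
    have hF1' : HasDerivAt F1 F2 (d x + b i * 0 + c * 0 ^ 2) := by simpa using hF1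
    have h2 := hF1'.comp (0:ℝ) (hp 0)
    have h3 : HasDerivAt (fun t : ℝ => b i + 2 * c * t) (2 * c) 0 := by
      simpa using ((hasDerivAt_id (0:ℝ)).const_mul (2 * c)).const_add (b i)
    have h4 := (h2.mul h3).deriv
    simp only [Function.comp_def] at h4
    erw [h4]
    simp; ring
  unfold lap
  rw [Finset.sum_congr rfl fun i _ => key i, Finset.sum_add_distrib, ← Finset.mul_sum]
  simp; ring


/-- Properties of the domain used in the proof. -/
structure GoodDom {N : ℕ} (Ω : Set (EuclN N)) : Prop where
  op : IsOpen Ω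
  bdd : Bornology.IsBounded Ω
  inv : ∀ x y : EuclN N, ‖x‖ = ‖y‖ → x ∈ Ω → y ∈ Ω
  ud : UniqueDiffOn ℝ (closure Ω)

/-- Infinitesimal rotation. -/
noncomputable def Xf {N : ℕ} (e ν x : EuclN N) : EuclN N := ⟪x, e⟫ • ν - ⟪x, ν⟫ • e

noncomputable def rotFun {N : ℕ} (e ν : EuclN N) (t : ℝ) (x : EuclN N) : EuclN N :=
  x + (Real.cos t - 1) • (⟪x, e⟫ • e + ⟪x, ν⟫ • ν) + Real.sin t • Xf e ν x

lemma rotFun_inner_e {N : ℕ} {e ν : EuclN N} (he : ‖e‖ = 1) (hen : ⟪e, ν⟫ = 0)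
    (t : ℝ) (x : EuclN N) : ⟪rotFun e ν t x, e⟫ = Real.cos t * ⟪x, e⟫ - Real.sin t * ⟪x, ν⟫ := by
  have h1 : ⟪e, e⟫ = 1 := by rw [real_inner_self_eq_norm_sq, he]; norm_num
  have h2 : ⟪ν, e⟫ = 0 := by rw [real_inner_comm]; exact hen
  simp only [rotFun, Xf, inner_add_left, inner_sub_left, real_inner_smul_left, h1, h2]
  ring

lemma rotFun_inner_n {N : ℕ} {e ν : EuclN N} (hn : ‖ν‖ = 1) (hen : ⟪e, ν⟫ = 0)
    (t : ℝ) (x : EuclN N) : ⟪rotFun e ν t x, ν⟫ = Real.cos t * ⟪x, ν⟫ + Real.sin t * ⟪x, e⟫ := by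
  have h1 : ⟪ν, ν⟫ = 1 := by rw [real_inner_self_eq_norm_sq, hn]; norm_num
  simp only [rotFun, Xf, inner_add_left, inner_sub_left, real_inner_smul_left, h1, hen]
  ring

lemma rotFun_norm {N : ℕ} {e ν : EuclN N} (he : ‖e‖ = 1) (hn : ‖ν‖ = 1) (hen : ⟪e, ν⟫ = 0)
    (t : ℝ) (x : EuclN N) : ‖rotFun e ν t x‖ = ‖x‖ := by
  have h1 : ⟪e, e⟫ = 1 := by rw [real_inner_self_eq_norm_sq, he]; norm_num
  have h2 : ⟪ν, e⟫ = 0 := by rw [real_inner_comm]; exact hen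
  have h3 : ⟪ν, ν⟫ = 1 := by rw [real_inner_self_eq_norm_sq, hn]; norm_num
  have hs := Real.sin_sq_add_cos_sq t
  have : ‖rotFun e ν t x‖ ^ 2 = ‖x‖ ^ 2 := by
    rw [← real_inner_self_eq_norm_sq, ← real_inner_self_eq_norm_sq]
    simp only [rotFun, Xf, inner_add_left, inner_sub_left, inner_add_right, inner_sub_right,
      real_inner_smul_left, real_inner_smul_right, h1, h2, h3, hen, real_inner_comm x e,
      real_inner_comm x ν]
    linear_combination (⟪x, e⟫ ^ 2 + ⟪x, ν⟫ ^ 2) * hs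
  exact (sq_eq_sq₀ (norm_nonneg _) (norm_nonneg _)).1 this

noncomputable def rotL {N : ℕ} {e ν : EuclN N} (he : ‖e‖ = 1) (hn : ‖ν‖ = 1) (hen : ⟪e, ν⟫ = 0)
    (t : ℝ) : EuclN N ≃ₗᵢ[ℝ] EuclN N :=
  LinearIsometry.toLinearIsometryEquiv
    { toFun := rotFun e ν t
      map_add' := fun x y => by
        simp only [rotFun, Xf, inner_add_left]; module
      map_smul' := fun c x => by
        simp only [rotFun, Xf, real_inner_smul_left, RingHom.id_apply]; module
      norm_map' := fun x => rotFun_norm he hn hen t x } rfl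

lemma rotL_apply {N : ℕ} {e ν : EuclN N} (he : ‖e‖ = 1) (hn : ‖ν‖ = 1) (hen : ⟪e, ν⟫ = 0)
    (t : ℝ) (x : EuclN N) : rotL he hn hen t x = rotFun e ν t x := rfl

lemma rotFun_zero {N : ℕ} (e ν x : EuclN N) : rotFun e ν 0 x = x := by simp [rotFun]

lemma rotFun_hasDerivAt {N : ℕ} {e ν : EuclN N} (he : ‖e‖ = 1) (hn : ‖ν‖ = 1) (hen : ⟪e, ν⟫ = 0)
    (t : ℝ) (x : EuclN N) :
    HasDerivAt (fun s => rotFun e ν s x) (Xf e ν (rotFun e ν t x)) t := by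
  have := ((((Real.hasDerivAt_cos t).sub_const 1).smul_const (⟪x, e⟫ • e + ⟪x, ν⟫ • ν)).const_add
    x).add ((Real.hasDerivAt_sin t).smul_const (Xf e ν x))
  refine HasDerivAt.congr_deriv this ?_
  rw [Xf, Xf, rotFun_inner_e he hen, rotFun_inner_n hn hen]
  module

lemma rotFun_continuous {N : ℕ} (e ν : EuclN N) :
    Continuous (fun q : ℝ × EuclN N => rotFun e ν q.1 q.2) := by
  unfold rotFun Xf
  fun_prop

/-- angular derivative -/
noncomputable def angD {N m : ℕ} (Ω : Set (EuclN N)) (U : Fin m → EuclN N → ℝ) (e ν : EuclN N)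
    (i : Fin m) (x : EuclN N) : ℝ := fderivWithin ℝ (U i) (closure Ω) x (Xf e ν x)

lemma angD_continuousOn {N m : ℕ} {Ω : Set (EuclN N)} (hΩ : GoodDom Ω) {U : Fin m → EuclN N → ℝ}
    (hUreg : ∀ i, ContDiffOn ℝ 2 (U i) (closure Ω)) (e ν : EuclN N) (i : Fin m) :
    ContinuousOn (angD Ω U e ν i) (closure Ω) := by
  unfold angD
  have h := (hUreg i).continuousOn_fderivWithin hΩ.ud (by norm_num)
  have h2 : Continuous (Xf e ν) := by unfold Xf; fun_prop
  exact h.clm_apply h2.continuousOn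

lemma rot_mem {N : ℕ} {Ω : Set (EuclN N)} (hΩ : GoodDom Ω) {e ν : EuclN N} (he : ‖e‖ = 1)
    (hn : ‖ν‖ = 1) (hen : ⟪e, ν⟫ = 0) (t : ℝ) {x : EuclN N} (hx : x ∈ Ω) : rotFun e ν t x ∈ Ω :=
  hΩ.inv x _ (rotFun_norm he hn hen t x).symm hx

lemma rot_mem_closure {N : ℕ} {Ω : Set (EuclN N)} (hΩ : GoodDom Ω) {e ν : EuclN N} (he : ‖e‖ = 1)
    (hn : ‖ν‖ = 1) (hen : ⟪e, ν⟫ = 0) (t : ℝ) {x : EuclN N} (hx : x ∈ closure Ω) :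
    rotFun e ν t x ∈ closure Ω := by
  have hc : Continuous (rotFun e ν t) := (rotL he hn hen t).continuous
  exact (show MapsTo (rotFun e ν t) Ω Ω from fun y hy => rot_mem hΩ he hn hen t hy).closure hc hx

lemma angD_hasDerivAt {N m : ℕ} {Ω : Set (EuclN N)} (hΩ : GoodDom Ω) {U : Fin m → EuclN N → ℝ}
    (hUreg : ∀ i, ContDiffOn ℝ 2 (U i) (closure Ω)) {e ν : EuclN N} (he : ‖e‖ = 1)
    (hn : ‖ν‖ = 1) (hen : ⟪e, ν⟫ = 0) (i : Fin m) {x : EuclN N} (hx : x ∈ closure Ω) (t : ℝ) :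
    HasDerivAt (fun s => U i (rotFun e ν s x)) (angD Ω U e ν i (rotFun e ν t x)) t := by
  have hm := rot_mem_closure hΩ he hn hen t hx
  have h1 := (((hUreg i).differentiableOn (by norm_num)) _ hm).hasFDerivWithinAt
  exact h1.comp_hasDerivAt t (rotFun_hasDerivAt he hn hen t x)
    (Eventually.of_forall fun s => rot_mem_closure hΩ he hn hen s hx)

lemma angD_frontier {N m : ℕ} {Ω : Set (EuclN N)} (hΩ : GoodDom Ω) {U : Fin m → EuclN N → ℝ}
    (hUreg : ∀ i, ContDiffOn ℝ 2 (U i) (closure Ω)) {e ν : EuclN N} (he : ‖e‖ = 1)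
    (hn : ‖ν‖ = 1) (hen : ⟪e, ν⟫ = 0) (hb : ∀ i, ∀ x ∈ frontier Ω, U i x = 0)
    (i : Fin m) {x : EuclN N} (hx : x ∈ frontier Ω) : angD Ω U e ν i x = 0 := by
  rw [hΩ.op.frontier_eq] at hx hb
  have h := angD_hasDerivAt hΩ hUreg he hn hen i hx.1 0
  have h0 : (fun s => U i (rotFun e ν s x)) = fun _ => 0 := by
    ext s
    refine hb i _ ⟨rot_mem_closure hΩ he hn hen s hx.1, fun hmem => hx.2 ?_⟩
    exact hΩ.inv _ _ (rotFun_norm he hn hen s x) hmem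
  rw [h0, rotFun_zero] at h
  exact h.unique (hasDerivAt_const _ _)

lemma angD_eq_fderiv {N m : ℕ} {Ω : Set (EuclN N)} (hΩ : GoodDom Ω) {U : Fin m → EuclN N → ℝ}
    {e ν : EuclN N} (i : Fin m) {x : EuclN N} (hx : x ∈ Ω) :
    angD Ω U e ν i x = fderiv ℝ (U i) x (Xf e ν x) := by
  rw [angD, fderivWithin_of_mem_nhds (mem_of_superset (hΩ.op.mem_nhds hx) subset_closure)]

lemma angD_T {N m : ℕ} {Ω : Set (EuclN N)} (hΩ : GoodDom Ω) {U : Fin m → EuclN N → ℝ}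
    (hUreg : ∀ i, ContDiffOn ℝ 2 (U i) (closure Ω)) {e : EuclN N} (he : ‖e‖ = 1) (ν : EuclN N)
    (hsymm : ∀ i, ∀ x ∈ Ω, U i (reflPt e x) = U i x)
    (i : Fin m) {x : EuclN N} (hx : x ∈ Ω) (hxe : ⟪x, e⟫ = 0) : angD Ω U e ν i x = 0 := by
  rw [angD_eq_fderiv hΩ i hx, Xf, hxe]
  have hd : DifferentiableAt ℝ (U i) x :=
    ((hUreg i).contDiffAt (mem_of_superset (hΩ.op.mem_nhds hx) subset_closure)).differentiableAt
      (by norm_num)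
  have hline : ∀ v : EuclN N, HasDerivAt (fun t : ℝ => x + t • v) v 0 := fun v => by
    simpa using ((hasDerivAt_id (0:ℝ)).smul_const v).const_add x
  have hD : ∀ v : EuclN N, HasDerivAt (fun t : ℝ => U i (x + t • v)) (fderiv ℝ (U i) x v) 0 := by
    intro v
    have : HasFDerivAt (U i) (fderiv ℝ (U i) x) (x + (0:ℝ) • v) := by simpa using hd.hasFDerivAt
    exact this.comp_hasDerivAt (0:ℝ) (hline v)
  have h1 := hD e
  have h2 := hD (-e)
  have heq : (fun t : ℝ => U i (x + t • (-e))) =ᶠ[𝓝 0] fun t => U i (x + t • e) := by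
    have : Tendsto (fun t : ℝ => x + t • e) (𝓝 0) (𝓝 x) := by
      simpa using (hline e).continuousAt.tendsto
    filter_upwards [this.eventually (hΩ.op.mem_nhds hx)] with t ht
    rw [← hsymm i _ ht]
    congr 1
    simp only [reflPt, inner_add_left, real_inner_smul_left, hxe, real_inner_self_eq_norm_sq, he]
    module
  have h3 := (h2.congr_of_eventuallyEq heq.symm).unique h1
  simp only [map_neg] at h3
  have h4 : fderiv ℝ (U i) x e = 0 := by linarith
  simp [h4]

/-- the zeroth-order term of the linearized operator -/
noncomputable def linT {N m : ℕ} (f : Fin m → ℝ → (Fin m → ℝ) → ℝ) (U V : Fin m → EuclN N → ℝ)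
    (i : Fin m) (x : EuclN N) : ℝ := ∑ j, pd (f i) j ‖x‖ (fun k => U k x) * V j x

lemma pd_joint {m : ℕ} {f : ℝ → (Fin m → ℝ) → ℝ}
    (hf : ContDiff ℝ 1 (fun q : ℝ × (Fin m → ℝ) => f q.1 q.2)) (j : Fin m) (r : ℝ)
    (s : Fin m → ℝ) :
    pd f j r s = fderiv ℝ (fun q : ℝ × (Fin m → ℝ) => f q.1 q.2) (r, s) (0, Pi.single j 1) := by
  have h1 := (hf.differentiable (by norm_num) (r, s)).hasFDerivAt
  have h2 := h1.comp s (hasFDerivAt_prodMk_right r s)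
  have h3 : fderiv ℝ (f r) s = _ := h2.fderiv
  rw [pd, h3]
  simp

lemma f_differentiable {m : ℕ} {f : ℝ → (Fin m → ℝ) → ℝ}
    (hf : ContDiff ℝ 1 (fun q : ℝ × (Fin m → ℝ) => f q.1 q.2)) (r : ℝ) :
    Differentiable ℝ (f r) := by
  intro s
  have h1 := (hf.differentiable (by norm_num) (r, s)).hasFDerivAt
  exact (h1.comp s (hasFDerivAt_prodMk_right r s)).differentiableAt

lemma pd_continuousOn {N m : ℕ} {f : ℝ → (Fin m → ℝ) → ℝ}
    (hf : ContDiff ℝ 1 (fun q : ℝ × (Fin m → ℝ) => f q.1 q.2)) {s : Set (EuclN N)}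
    {U : Fin m → EuclN N → ℝ} (hU : ∀ i, ContinuousOn (U i) s) (j : Fin m) :
    ContinuousOn (fun x => pd f j ‖x‖ (fun k => U k x)) s := by
  simp only [pd_joint hf]
  have h1 : Continuous (fderiv ℝ (fun q : ℝ × (Fin m → ℝ) => f q.1 q.2)) :=
    hf.continuous_fderiv (by norm_num)
  have h2 : ContinuousOn (fun x : EuclN N => ((‖x‖, fun k => U k x) : ℝ × (Fin m → ℝ))) s :=
    continuous_norm.continuousOn.prodMk (continuousOn_pi.2 hU)
  exact (h1.comp_continuousOn h2).clm_apply continuousOn_const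

lemma linT_hasDerivAt {N m : ℕ} {Ω : Set (EuclN N)} (hΩ : GoodDom Ω)
    {f : Fin m → ℝ → (Fin m → ℝ) → ℝ}
    (hf : ∀ i, ContDiff ℝ 1 (fun q : ℝ × (Fin m → ℝ) => f i q.1 q.2)) {U : Fin m → EuclN N → ℝ}
    (hUreg : ∀ i, ContDiffOn ℝ 2 (U i) (closure Ω)) {e ν : EuclN N} (he : ‖e‖ = 1)
    (hn : ‖ν‖ = 1) (hen : ⟪e, ν⟫ = 0) (i : Fin m) {x : EuclN N} (hx : x ∈ closure Ω) (t : ℝ) :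
    HasDerivAt (fun s => f i ‖x‖ (fun k => U k (rotFun e ν s x)))
      (linT f U (angD Ω U e ν) i (rotFun e ν t x)) t := by
  have h1 : HasDerivAt (fun s => fun k => U k (rotFun e ν s x))
      (fun k => angD Ω U e ν k (rotFun e ν t x)) t :=
    hasDerivAt_pi.2 fun k => angD_hasDerivAt hΩ hUreg he hn hen k hx t
  have h2 := (f_differentiable (hf i) ‖x‖ (fun k => U k (rotFun e ν t x))).hasFDerivAt
  refine (h2.comp_hasDerivAt t h1).congr_deriv ?_
  simp only [linT, rotFun_norm he hn hen, pd]
  refine (LinearMap.pi_apply_eq_sum_univ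
    (fderiv ℝ (f i ‖x‖) fun k => U k (rotFun e ν t x)).toLinearMap _).trans ?_
  refine Finset.sum_congr rfl fun j _ => ?_
  rw [smul_eq_mul, mul_comm]
  have hj : (fun k => if j = k then (1:ℝ) else 0) = Pi.single j 1 := by
    ext k
    simp [Pi.single_apply, eq_comm]
  rw [hj]
  rfl

lemma linT_continuousOn {N m : ℕ} {Ω : Set (EuclN N)} (hΩ : GoodDom Ω)
    {f : Fin m → ℝ → (Fin m → ℝ) → ℝ}
    (hf : ∀ i, ContDiff ℝ 1 (fun q : ℝ × (Fin m → ℝ) => f i q.1 q.2)) {U : Fin m → EuclN N → ℝ}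
    (hUreg : ∀ i, ContDiffOn ℝ 2 (U i) (closure Ω)) (e ν : EuclN N) (i : Fin m) :
    ContinuousOn (linT f U (angD Ω U e ν) i) (closure Ω) := by
  unfold linT
  exact continuousOn_finsetSum _ fun j _ =>
    (pd_continuousOn (hf i) (fun k => (hUreg k).continuousOn) j).mul
      (angD_continuousOn hΩ hUreg e ν j)


lemma norm_sq_line {N : ℕ} (x y : EuclN N) (i : Fin N) (t : ℝ) :
    ‖x + t • (EuclideanSpace.single i (1:ℝ) : EuclN N) - y‖ ^ 2 =
      ‖x - y‖ ^ 2 + (2 * (x - y) i) * t + 1 * t ^ 2 := by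
  have : x + t • (EuclideanSpace.single i (1:ℝ) : EuclN N) - y =
    (x - y) + t • (EuclideanSpace.single i (1:ℝ) : EuclN N) := by abel
  rw [this, norm_add_sq_real, real_inner_smul_right, norm_smul, EuclideanSpace.inner_single_right]
  simp
  ring

lemma contDiff_normSq {N : ℕ} (y : EuclN N) : ContDiff ℝ 2 (fun x : EuclN N => ‖x - y‖ ^ 2) :=
  (contDiff_id.sub contDiff_const).norm_sq ℝ

lemma lap_normSq {N : ℕ} (x y : EuclN N) : lap (fun x : EuclN N => ‖x - y‖ ^ 2) x = 2 * N := by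
  have := lap_comp_quad (F := fun s => s) (F1 := fun _ => 1) (F2 := 0) (x := x)
    (d := fun x : EuclN N => ‖x - y‖ ^ 2)
    (fun i => 2 * (x - y) i) 1 (fun i t => norm_sq_line x y i t)
    (Eventually.of_forall fun s => hasDerivAt_id s) (hasDerivAt_const _ _)
    (contDiff_normSq y).contDiffAt
  simpa using this

lemma angD_visc {N m : ℕ} {Ω : Set (EuclN N)} (hΩ : GoodDom Ω)
    {f : Fin m → ℝ → (Fin m → ℝ) → ℝ}
    (hf : ∀ i, ContDiff ℝ 1 (fun q : ℝ × (Fin m → ℝ) => f i q.1 q.2)) {U : Fin m → EuclN N → ℝ}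
    (hUreg : ∀ i, ContDiffOn ℝ 2 (U i) (closure Ω))
    (hsol : ∀ i, ∀ x ∈ Ω, -lap (U i) x = f i ‖x‖ (fun k => U k x))
    {e ν : EuclN N} (he : ‖e‖ = 1)
    (hn : ‖ν‖ = 1) (hen : ⟪e, ν⟫ = 0) (i : Fin m) {x₀ : EuclN N} (hx : x₀ ∈ Ω)
    {φ : EuclN N → ℝ} (hφ : ContDiffAt ℝ 2 φ x₀)
    (hmax : IsLocalMax (fun y => angD Ω U e ν i y - φ y) x₀) :
    -linT f U (angD Ω U e ν) i x₀ ≤ lap φ x₀ := by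
  by_contra hcon
  push Not at hcon
  set V := angD Ω U e ν i with hV
  set G := linT f U (angD Ω U e ν) i with hG
  have hnh : closure Ω ∈ 𝓝 x₀ := mem_of_superset (hΩ.op.mem_nhds hx) subset_closure
  have hGc : ContinuousAt G x₀ := (linT_continuousOn hΩ hf hUreg e ν i).continuousAt hnh
  have hVc : ContinuousAt V x₀ := (angD_continuousOn hΩ hUreg e ν i).continuousAt hnh
  -- choose η
  obtain ⟨η, hη, hη2⟩ : ∃ η : ℝ, 0 < η ∧ lap φ x₀ + 4 * η * N + 2 * η < - G x₀ := by
    refine ⟨(-G x₀ - lap φ x₀) / (8 * N + 8), by apply div_pos; linarith; positivity, ?_⟩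
    have hN : (0:ℝ) < 8 * N + 8 := by positivity
    have : (-G x₀ - lap φ x₀) / (8 * N + 8) * (8 * N + 8) = -G x₀ - lap φ x₀ := by field_simp
    have h2 : 0 < (-G x₀ - lap φ x₀) / (8 * N + 8) := by apply div_pos; linarith; positivity
    nlinarith
  have hlapc := lap_continuousAt hφ
  -- neighbourhoods
  have ev : ∀ᶠ y in 𝓝 x₀, y ∈ Ω ∧ ContDiffAt ℝ 2 φ y ∧ V y - φ y ≤ V x₀ - φ x₀ ∧
      lap φ y < lap φ x₀ + η ∧ -G x₀ - η < - G y := by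
    refine (hΩ.op.eventually_mem hx).and ((hφ.eventually (by simp)).and (hmax.and ?_))
    refine (hlapc.eventually (gt_mem_nhds (by linarith))).and ?_
    exact hGc.neg.eventually (lt_mem_nhds (by simp only [Pi.neg_apply]; linarith))
  obtain ⟨ρ, hρ, hball⟩ := Metric.eventually_nhds_iff_ball.1 ev
  set r := ρ / 2 with hr
  have hr0 : 0 < r := by positivity
  have hrρ : r < ρ := by rw [hr]; linarith
  -- rotation stays close
  have hK : IsCompact (Metric.closedBall x₀ r) := isCompact_closedBall _ _
  have hKΩ : Metric.closedBall x₀ r ⊆ Ω := fun y hy =>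
    (hball y (Metric.closedBall_subset_ball hrρ hy)).1
  obtain ⟨h, hh, hclose, hclose2⟩ : ∃ h : ℝ, 0 < h ∧ (∀ θ ∈ Ioo 0 h, ∀ y ∈ Metric.closedBall x₀ r,
      |V (rotFun e ν θ y) - V y| < η * r ^ 2 / 3) ∧
      (∀ θ ∈ Ioo 0 h, ∀ y ∈ Metric.closedBall x₀ r, rotFun e ν θ y ∈ Metric.ball x₀ ρ) := by
    have hcts : ∀ y ∈ Metric.closedBall x₀ r, ∀ᶠ q : EuclN N × ℝ in 𝓝 (y, (0:ℝ)),
        |V (rotFun e ν q.2 q.1) - V q.1| < η * r ^ 2 / 3 ∧ rotFun e ν q.2 q.1 ∈ Metric.ball x₀ ρ := by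
      intro y hy
      have hVy : ContinuousAt V y := (angD_continuousOn hΩ hUreg e ν i).continuousAt
        (mem_of_superset (hΩ.op.mem_nhds (hKΩ hy)) subset_closure)
      have h1 : Tendsto (fun q : EuclN N × ℝ => rotFun e ν q.2 q.1) (𝓝 (y, (0:ℝ))) (𝓝 y) := by
        have := ((rotFun_continuous e ν).comp continuous_swap).tendsto (y, (0:ℝ))
        simpa [rotFun_zero, Function.comp_def] using this
      have h2 : Tendsto (fun q : EuclN N × ℝ => q.1) (𝓝 (y, (0:ℝ))) (𝓝 y) :=
        continuous_fst.tendsto (y, (0:ℝ))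
      have h3 := ((hVy.tendsto.comp h1).sub (hVy.tendsto.comp h2)).abs
      simp only [sub_self, abs_zero] at h3
      refine (h3.eventually (gt_mem_nhds (by positivity))).and (h1.eventually ?_)
      exact Metric.isOpen_ball.mem_nhds (Metric.closedBall_subset_ball hrρ hy)
    have := hK.eventually_forall_of_forall_eventually (x₀ := (0:ℝ))
      (P := fun t y => |V (rotFun e ν t y) - V y| < η * r ^ 2 / 3 ∧
        rotFun e ν t y ∈ Metric.ball x₀ ρ) (by
      intro y hy
      have := continuous_swap.tendsto ((0:ℝ), y)
      exact this.eventually (hcts y hy))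
    obtain ⟨h, hh, hb⟩ := Metric.eventually_nhds_iff.1 this
    have hab : ∀ θ ∈ Ioo 0 h, dist θ 0 < h := fun θ hθ => by
      rw [Real.dist_0_eq_abs, abs_of_pos hθ.1]; exact hθ.2
    exact ⟨h, hh, fun θ hθ y hy => (hb (hab θ hθ) y hy).1, fun θ hθ y hy => (hb (hab θ hθ) y hy).2⟩
  -- use parameter h' = h/2
  set k := h / 2 with hk
  have hk0 : 0 < k := by positivity
  have hkh : k < h := by rw [hk]; linarith
  set W : EuclN N → ℝ := fun y => k⁻¹ * (U i (rotFun e ν k y) - U i y) with hW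
  have hWV : ∀ y ∈ Ω, ∃ θ ∈ Ioo 0 h, W y = V (rotFun e ν θ y) := by
    intro y hy
    have hd := fun t => angD_hasDerivAt hΩ hUreg he hn hen i (subset_closure hy) t
    obtain ⟨θ, hθ, hh⟩ := exists_hasDerivAt_eq_slope (fun s => U i (rotFun e ν s y)) _ hk0
      (fun t _ => (hd t).continuousAt.continuousWithinAt) (fun t _ => hd t)
    refine ⟨θ, ⟨hθ.1, hθ.2.trans hkh⟩, ?_⟩
    rw [hV, hh, hW]
    simp only [rotFun_zero, sub_zero]
    field_simp
  have hUat : ∀ y ∈ Ω, ContDiffAt ℝ 2 (U i) y := fun y hy =>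
    (hUreg i).contDiffAt (mem_of_superset (hΩ.op.mem_nhds hy) subset_closure)
  have hUrot : ∀ y ∈ Ω, ContDiffAt ℝ 2 (fun y => U i (rotFun e ν k y)) y := fun y hy =>
    ContDiffAt.comp y (hUat _ (rot_mem hΩ he hn hen k hy)) (rotL he hn hen k).contDiff.contDiffAt
  have hWat : ∀ y ∈ Ω, ContDiffAt ℝ 2 W y := fun y hy =>
    contDiffAt_const.mul ((hUrot y hy).sub (hUat y hy))
  have hWlap : ∀ y ∈ Ω, ∃ θ ∈ Ioo 0 h, lap W y = - G (rotFun e ν θ y) := by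
    intro y hy
    have hd := fun t => linT_hasDerivAt hΩ hf hUreg he hn hen i (subset_closure hy) t
    obtain ⟨θ, hθ, hh⟩ := exists_hasDerivAt_eq_slope
      (fun s => f i ‖y‖ (fun k => U k (rotFun e ν s y))) _ hk0
      (fun t _ => (hd t).continuousAt.continuousWithinAt) (fun t _ => hd t)
    refine ⟨θ, ⟨hθ.1, hθ.2.trans hkh⟩, ?_⟩
    rw [hG, hh, hW, lap_smul _ ((hUrot y hy).sub (hUat y hy)), lap_sub (hUrot y hy) (hUat y hy)]
    have h1 := lap_isometry (rotL he hn hen k) (u := U i) (x := y)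
      (hUat _ (rot_mem hΩ he hn hen k hy))
    simp only [rotL_apply] at h1
    have h2 := hsol i y hy
    have h3 := hsol i _ (rot_mem hΩ he hn hen k hy)
    rw [rotFun_norm he hn hen] at h3
    rw [h1, ← h3]
    simp only [rotFun_zero, sub_zero]
    rw [← h2]
    field_simp
    ring
  -- maximize
  set Z : EuclN N → ℝ := fun y => W y - (φ y + 2 * η * ‖y - x₀‖ ^ 2) with hZ
  have hZat : ∀ y ∈ Metric.closedBall x₀ r, ContDiffAt ℝ 2 Z y := fun y hy =>
    (hWat y (hKΩ hy)).sub ((hball y (Metric.closedBall_subset_ball hrρ hy)).2.1.add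
      (contDiffAt_const.mul (contDiff_normSq x₀).contDiffAt))
  obtain ⟨z, hz, hzmax⟩ := hK.exists_isMaxOn ⟨x₀, Metric.mem_closedBall_self hr0.le⟩
    (f := Z) (fun y hy => (hZat y hy).continuousAt.continuousWithinAt)
  have hWclose : ∀ y ∈ Metric.closedBall x₀ r, |W y - V y| < η * r ^ 2 / 3 := by
    intro y hy
    obtain ⟨θ, hθ, h1⟩ := hWV y (hKΩ hy)
    rw [h1]; exact hclose θ hθ y hy
  have hzin : z ∈ Metric.ball x₀ r := by
    by_contra hnot
    have hzr : ‖z - x₀‖ = r := by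
      rw [Metric.mem_closedBall, dist_eq_norm] at hz
      rw [Metric.mem_ball, dist_eq_norm] at hnot
      linarith
    have h1 := hzmax (Metric.mem_closedBall_self hr0.le : x₀ ∈ Metric.closedBall x₀ r)
    simp only [mem_ofPred_eq, hZ, hzr, sub_self, norm_zero] at h1
    have h2 := abs_lt.1 (hWclose z hz)
    have h3 := abs_lt.1 (hWclose x₀ (Metric.mem_closedBall_self hr0.le))
    have h4 := (hball z (Metric.closedBall_subset_ball hrρ hz)).2.2.1
    have : 0 < η * r ^ 2 := by positivity
    nlinarith
  have hloc : IsLocalMax Z z := hzmax.isLocalMax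
    (mem_of_superset (Metric.isOpen_ball.mem_nhds hzin) Metric.ball_subset_closedBall)
  have hlap := lap_nonpos_of_localMax (hZat z hz) hloc
  have hφz := hball z (Metric.closedBall_subset_ball hrρ hz)
  rw [hZ, lap_sub (hWat z (hKΩ hz)) (hφz.2.1.add (contDiffAt_const.mul (contDiff_normSq x₀).contDiffAt)),
    lap_add hφz.2.1 (contDiffAt_const.mul (contDiff_normSq x₀).contDiffAt),
    lap_smul _ (contDiff_normSq x₀).contDiffAt, lap_normSq] at hlap
  obtain ⟨θ, hθ, h1⟩ := hWlap z (hKΩ hz)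
  have h2 := (hball _ (hclose2 θ hθ z hz)).2.2.2.2
  have h3 := hφz.2.2.2.1
  rw [h1] at hlap
  linarith


lemma sum_sq_coord {N : ℕ} (x : EuclN N) : ∑ i, (2 * x i) ^ 2 = 4 * ‖x‖ ^ 2 := by
  rw [EuclideanSpace.norm_sq_eq, Finset.mul_sum]
  refine Finset.sum_congr rfl fun i _ => ?_
  rw [Real.norm_eq_abs, sq_abs]; ring

lemma lap_gauss {N : ℕ} (α C : ℝ) (x y : EuclN N) :
    lap (fun x : EuclN N => Real.exp (-α * ‖x - y‖ ^ 2) - C) x =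
      (4 * α ^ 2 * ‖x - y‖ ^ 2 - 2 * N * α) * Real.exp (-α * ‖x - y‖ ^ 2) := by
  have hexp : ∀ s : ℝ, HasDerivAt (fun s => Real.exp (-α * s)) (-α * Real.exp (-α * s)) s := by
    intro s
    have := ((hasDerivAt_id s).const_mul (-α)).exp
    simpa [mul_comm] using this
  have := lap_comp_quad (F := fun s => Real.exp (-α * s) - C)
    (F1 := fun s => -α * Real.exp (-α * s))
    (F2 := -α * (-α * Real.exp (-α * ‖x - y‖ ^ 2))) (x := x)
    (d := fun x : EuclN N => ‖x - y‖ ^ 2)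
    (fun i => 2 * (x - y) i) 1 (fun i t => norm_sq_line x y i t)
    (Eventually.of_forall fun s => (hexp s).sub_const C) ((hexp _).const_mul (-α))
    (((contDiff_const.mul (contDiff_normSq y)).exp.sub contDiff_const).contDiffAt)
  rw [this, sum_sq_coord]
  ring

lemma strong_ball {N : ℕ} {D : Set (EuclN N)} {w : EuclN N → ℝ} {Λ : ℝ}
    (hΛ : 0 ≤ Λ) (hwc : ContinuousOn w D) (hw0 : ∀ x ∈ D, 0 ≤ w x)
    (hv : ∀ x ∈ D, ∀ ψ : EuclN N → ℝ, ContDiffAt ℝ 2 ψ x → IsLocalMin (fun y => w y - ψ y) x →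
      lap ψ x ≤ Λ * w x) {y : EuclN N} {R : ℝ} (hR : 0 < R) (hB : Metric.closedBall y R ⊆ D)
    (hy : 0 < w y) : ∀ x ∈ Metric.ball y R, 0 < w x := by
  intro z hz
  by_contra hneg
  push Not at hneg
  have hyB : y ∈ Metric.ball y R := Metric.mem_ball_self hR
  have hwy : ContinuousAt w y := hwc.continuousAt
    (mem_of_superset (Metric.isOpen_ball.mem_nhds hyB) (Metric.ball_subset_closedBall.trans hB))
  obtain ⟨ρ, hρ, hρw⟩ := Metric.eventually_nhds_iff_ball.1 (hwy.eventually (lt_mem_nhds hy))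
  set r := min (ρ / 2) (R / 2) with hr
  have hr0 : 0 < r := by positivity
  have hrρ : r < ρ := lt_of_le_of_lt (min_le_left _ _) (by linarith)
  have hrR : r < R := lt_of_le_of_lt (min_le_right _ _) (by linarith)
  have hpos : ∀ x ∈ Metric.closedBall y r, 0 < w x := fun x hx =>
    hρw x (Metric.closedBall_subset_ball hrρ hx)
  obtain ⟨x1, hx1, hmin1⟩ := (isCompact_closedBall y r).exists_isMinOn
    ⟨y, Metric.mem_closedBall_self hr0.le⟩
    (hwc.mono ((Metric.closedBall_subset_closedBall hrR.le).trans hB))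
  set c0 := w x1 with hc0
  have hc0p : 0 < c0 := hpos x1 hx1
  set α : ℝ := 1 + (2 * N + Λ + 1) / (4 * r ^ 2) with hα
  have hα1 : 1 ≤ α := by rw [hα]; have : 0 ≤ (2 * N + Λ + 1) / (4 * r ^ 2) := by positivity
                         linarith
  have hα2 : 2 * N + Λ + 1 ≤ 4 * α * r ^ 2 := by
    have : (2 * N + Λ + 1) / (4 * r ^ 2) * (4 * r ^ 2) = 2 * N + Λ + 1 := by field_simp
    rw [hα]; nlinarith [sq_nonneg r]
  set C := Real.exp (-α * R ^ 2) with hC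
  have hCp : 0 < C := Real.exp_pos _
  set b : EuclN N → ℝ := fun x => Real.exp (-α * ‖x - y‖ ^ 2) - C with hb
  have hbC : ContDiff ℝ 2 b := (contDiff_const.mul (contDiff_normSq y)).exp.sub contDiff_const
  set ε := c0 / 2 with hε
  have hεp : 0 < ε := by positivity
  set A := Metric.closedBall y R \ Metric.ball y r with hA
  have hAc : IsCompact A := (isCompact_closedBall y R).diff Metric.isOpen_ball
  have hzA : z ∈ A := ⟨Metric.ball_subset_closedBall hz, fun h =>
    absurd (hpos z (Metric.ball_subset_closedBall h)) (not_lt.2 hneg)⟩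
  have hAD : A ⊆ D := fun x hx => hB hx.1
  obtain ⟨x, hx, hxmin⟩ := hAc.exists_isMinOn ⟨z, hzA⟩ (f := fun x => w x - ε * b x)
    ((hwc.mono hAD).sub (continuous_const.mul hbC.continuous).continuousOn)
  have hbz : 0 < b z := by
    rw [hb, hC]
    simp only [sub_pos, Real.exp_lt_exp]
    rw [Metric.mem_ball, dist_eq_norm] at hz
    have : ‖z - y‖ ^ 2 < R ^ 2 := by gcongr
    nlinarith
  have hval : w x - ε * b x < 0 := by
    have h1 : w x - ε * b x ≤ w z - ε * b z := hxmin hzA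
    have : 0 < ε * b z := by positivity
    linarith
  have hwx := hw0 x (hAD hx)
  have hxR : x ∈ Metric.ball y R := by
    by_contra hnot
    have hxr : ‖x - y‖ = R := by
      have h1 := hx.1
      rw [Metric.mem_closedBall, dist_eq_norm] at h1
      rw [Metric.mem_ball, dist_eq_norm] at hnot
      linarith
    have : b x = 0 := by simp [hb, hC, hxr]
    rw [this] at hval
    linarith
  have hxr : x ∉ Metric.closedBall y r := by
    intro hcb
    have h1 : c0 ≤ w x := hmin1 hcb
    have h2 : b x ≤ 1 := by
      have : Real.exp (-α * ‖x - y‖ ^ 2) ≤ 1 := by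
        rw [Real.exp_le_one_iff]; nlinarith [sq_nonneg ‖x - y‖]
      rw [hb]; simp only; linarith
    have : ε * b x ≤ ε := by nlinarith
    linarith
  have hnh : A ∈ 𝓝 x := by
    have : Metric.ball y R ∩ (Metric.closedBall y r)ᶜ ∈ 𝓝 x :=
      (Metric.isOpen_ball.inter Metric.isClosed_closedBall.isOpen_compl).mem_nhds ⟨hxR, hxr⟩
    refine mem_of_superset this fun q hq => ⟨Metric.ball_subset_closedBall hq.1, fun h => hq.2 ?_⟩
    exact Metric.ball_subset_closedBall h
  have hlap := hv x (hAD hx) (fun y => ε * b y) (contDiffAt_const.mul hbC.contDiffAt)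
    (hxmin.isLocalMin hnh)
  rw [lap_smul _ hbC.contDiffAt, hb, lap_gauss] at hlap
  have hxr' : r ≤ ‖x - y‖ := by
    have := hx.2
    rw [Metric.mem_ball, dist_eq_norm] at this
    linarith
  have hxr2 : r ^ 2 ≤ ‖x - y‖ ^ 2 := by gcongr
  set E := Real.exp (-α * ‖x - y‖ ^ 2) with hE
  have hEp : 0 < E := Real.exp_pos _
  have hcoef : Λ + 1 ≤ 4 * α ^ 2 * ‖x - y‖ ^ 2 - 2 * N * α := by
    have h1 : Λ + 1 ≤ 4 * α * ‖x - y‖ ^ 2 - 2 * N := by nlinarith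
    nlinarith
  have h1 : w x ≤ ε * E := by
    have : ε * b x ≤ ε * E := by
      apply mul_le_mul_of_nonneg_left _ hεp.le
      simp only [hb, ← hE]; linarith
    linarith
  have h2 : ε * ((Λ + 1) * E) ≤ Λ * (ε * E) := by
    calc ε * ((Λ + 1) * E) ≤ ε * ((4 * α ^ 2 * ‖x - y‖ ^ 2 - 2 * N * α) * E) := by gcongr
      _ ≤ Λ * w x := hlap
      _ ≤ Λ * (ε * E) := by gcongr
  have : 0 < ε * E := by positivity
  nlinarith

lemma strong_max {N : ℕ} {D : Set (EuclN N)} {w : EuclN N → ℝ} {Λ : ℝ} (hDo : IsOpen D)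
    (hDc : IsPreconnected D)
    (hΛ : 0 ≤ Λ) (hwc : ContinuousOn w D) (hw0 : ∀ x ∈ D, 0 ≤ w x)
    (hv : ∀ x ∈ D, ∀ ψ : EuclN N → ℝ, ContDiffAt ℝ 2 ψ x → IsLocalMin (fun y => w y - ψ y) x →
      lap ψ x ≤ Λ * w x) : (∀ x ∈ D, w x = 0) ∨ (∀ x ∈ D, 0 < w x) := by
  by_contra hcon
  push Not at hcon
  obtain ⟨⟨p, hp, hp0⟩, q, hq, hq0⟩ := hcon
  have hpp : 0 < w p := lt_of_le_of_ne (hw0 p hp) (Ne.symm hp0)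
  -- sets
  let P : Set (EuclN N) := {x ∈ D | 0 < w x}
  let Z : Set (EuclN N) := {x ∈ D | ∃ r > 0, Metric.ball x r ⊆ D ∧ ∀ y ∈ Metric.ball x r, w y = 0}
  have hPo : IsOpen P := hwc.isOpen_inter_preimage hDo isOpen_Ioi
  have hZo : IsOpen Z := by
    rw [Metric.isOpen_iff]
    rintro x ⟨hx, r, hr, hrD, hr0⟩
    refine ⟨r, hr, fun y hy => ⟨hrD hy, r - dist y x, by rw [Metric.mem_ball] at hy; linarith, ?_, ?_⟩⟩
    · exact (Metric.ball_subset_ball' (by linarith)).trans hrD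
    · exact fun z hz => hr0 z (Metric.ball_subset_ball' (by linarith) hz)
  have hcov : D ⊆ P ∪ Z := by
    intro x hx
    by_cases hwx : 0 < w x
    · exact Or.inl ⟨hx, hwx⟩
    right
    obtain ⟨r, hr, hrD⟩ := Metric.isOpen_iff.1 hDo x hx
    refine ⟨hx, r / 4, by positivity, (Metric.ball_subset_ball (by linarith)).trans hrD, ?_⟩
    intro y hy
    by_contra hne
    have hyD : y ∈ D := hrD (Metric.ball_subset_ball (by linarith) hy)
    have hyp : 0 < w y := lt_of_le_of_ne (hw0 y hyD) (Ne.symm hne)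
    refine hwx (strong_ball hΛ hwc hw0 hv (y := y) (R := r / 2) (by positivity) ?_ hyp x ?_)
    · refine fun z hz => hrD ?_
      rw [Metric.mem_closedBall] at hz
      rw [Metric.mem_ball] at hy ⊢
      linarith [dist_triangle z y x]
    · rw [Metric.mem_ball] at hy ⊢
      rw [dist_comm]; linarith
  obtain ⟨x, hx, hxP, hxZ⟩ := hDc P Z hPo hZo hcov ⟨p, hp, hp, hpp⟩ (by
    rcases hcov hq with h | h
    · exact absurd h.2 (not_lt.2 hq0)
    · exact ⟨q, hq, h⟩)
  obtain ⟨_, r, hr, _, h0⟩ := hxZ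
  have := h0 x (Metric.mem_ball_self hr)
  linarith [hxP.2]

lemma exists_max_family {N m : ℕ} {K : Set (EuclN N)} (hK : IsCompact K) (hne : K.Nonempty)
    (h0 : 0 < m)
    {h : Fin m → EuclN N → ℝ} (hc : ∀ i, ContinuousOn (h i) K) :
    ∃ i, ∃ x ∈ K, ∀ j, ∀ y ∈ K, h j y ≤ h i x := by
  choose z hz hmax using fun i => hK.exists_isMaxOn hne (hc i)
  have : Nonempty (Fin m) := ⟨⟨0, h0⟩⟩
  obtain ⟨i, hi⟩ := Finite.exists_max (fun i => h i (z i))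
  exact ⟨i, z i, hz i, fun j y hy => (hmax j hy).trans (hi j)⟩

/-- Abstract data of a cooperative linear problem. -/
structure LinData {N m : ℕ} (D : Set (EuclN N)) (J : Fin m → Fin m → EuclN N → ℝ)
    (V Ψ : Fin m → EuclN N → ℝ) (Λ : ℝ) (g : EuclN N → ℝ) (K : Set (EuclN N)) : Prop where
  hm : 0 < m
  op : IsOpen D
  conn : IsPreconnected D
  bdd : Bornology.IsBounded D
  coop : ∀ i j, i ≠ j → ∀ x ∈ D, 0 ≤ J i j x
  Vc : ∀ i, ContinuousOn (V i) (closure D)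
  Vb : ∀ i, ∀ x ∈ closure D, x ∉ D → V i x = 0
  visc : ∀ i, ∀ x ∈ D, ∀ φ : EuclN N → ℝ, ContDiffAt ℝ 2 φ x →
    IsLocalMax (fun y => V i y - φ y) x → -(∑ j, J i j x * V j x) ≤ lap φ x
  Ψc : ∀ i, ∀ x ∈ D, ContDiffAt ℝ 2 (Ψ i) x
  Ψp : ∀ i, ∀ x ∈ D, 0 < Ψ i x
  Ψs : ∀ i, ∀ x ∈ D, 0 ≤ -lap (Ψ i) x - ∑ j, J i j x * Ψ j x
  Λ0 : 0 ≤ Λ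
  Λb : ∀ i, ∀ x ∈ D, ∑ j, |J i j x| ≤ Λ
  gc : ∀ x ∈ D, ContDiffAt ℝ 2 g x
  g1 : ∀ x ∈ D, 1 ≤ g x
  Kc : IsCompact K
  KD : K ⊆ D
  gs : ∀ x ∈ D, x ∉ K → lap g x + Λ * g x < 0
  coup : ∀ I J' : Finset (Fin m), I.Nonempty → J'.Nonempty → Disjoint I J' → I ∪ J' = Finset.univ →
    ∃ i₀ ∈ I, ∃ j₀ ∈ J', ∃ x ∈ D, 0 < J i₀ j₀ x

lemma LinData.comparison {N m : ℕ} {D : Set (EuclN N)} {J : Fin m → Fin m → EuclN N → ℝ}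
    {V Ψ : Fin m → EuclN N → ℝ} {Λ : ℝ} {g : EuclN N → ℝ} {K : Set (EuclN N)}
    (H : LinData D J V Ψ Λ g K) {t : ℝ} (ht : 0 ≤ t) (hK : ∀ i, ∀ x ∈ K, V i x ≤ t * Ψ i x) :
    ∀ i, ∀ x ∈ D, V i x ≤ t * Ψ i x := by
  intro i y hy
  by_contra hcon
  push Not at hcon
  have hgp : ∀ x ∈ D, 0 < g x := fun x hx => lt_of_lt_of_le one_pos (H.g1 x hx)
  set h : Fin m → EuclN N → ℝ := fun j x => (V j x - t * Ψ j x) / g x with hh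
  set ε := h i y with hε
  have hεp : 0 < ε := div_pos (by linarith) (hgp y hy)
  have hle : ∀ j, ∀ x ∈ D, 0 < h j x → h j x ≤ V j x := by
    intro j x hx hpos
    have h1 : 0 < V j x - t * Ψ j x := by
      by_contra hn
      exact absurd hpos (not_lt.2 (div_nonpos_of_nonpos_of_nonneg (not_lt.1 hn) (hgp x hx).le))
    calc h j x ≤ V j x - t * Ψ j x := div_le_self h1.le (H.g1 x hx)
      _ ≤ V j x := by have := mul_nonneg ht (H.Ψp j x hx).le; linarith
  set S : Set (EuclN N) := ⋃ j, {x ∈ closure D | ε ≤ V j x} with hS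
  have hScomp : IsCompact S := by
    refine isCompact_iUnion fun j => ?_
    have hcl : IsClosed {x ∈ closure D | ε ≤ V j x} :=
      (H.Vc j).preimage_isClosed_of_isClosed isClosed_closure isClosed_Ici
    exact H.bdd.isCompact_closure.of_isClosed_subset hcl fun x hx => hx.1
  have hSD : S ⊆ D := by
    intro x hx
    obtain ⟨j, hj⟩ := mem_iUnion.1 hx
    by_contra hn
    have := H.Vb j x hj.1 hn
    have h2 := hj.2
    linarith
  have hyS : y ∈ S := mem_iUnion.2 ⟨i, subset_closure hy, hle i y hy hεp⟩
  have hcont : ∀ j, ContinuousOn (h j) D := fun j =>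
    (((H.Vc j).mono subset_closure).sub (continuousOn_const.mul fun x hx =>
      (H.Ψc j x hx).continuousAt.continuousWithinAt)).div
      (fun x hx => (H.gc x hx).continuousAt.continuousWithinAt) fun x hx => (hgp x hx).ne'
  obtain ⟨k, x, hxS, hmax⟩ := exists_max_family hScomp ⟨y, hyS⟩ H.hm fun j => (hcont j).mono hSD
  have hxD := hSD hxS
  set M := h k x with hM
  have hMε : ε ≤ M := hmax i y hyS
  have hMp : 0 < M := hεp.trans_le hMε
  have hall : ∀ j, ∀ z ∈ D, V j z - t * Ψ j z ≤ M * g z := by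
    intro j z hz
    have : h j z ≤ M := by
      by_cases hzS : z ∈ S
      · exact hmax j z hzS
      · refine le_trans (le_of_not_gt fun hgt => hzS ?_) hMε
        exact mem_iUnion.2 ⟨j, subset_closure hz, hgt.le.trans (hle j z hz (hεp.trans hgt))⟩
    rwa [hh, div_le_iff₀ (hgp z hz)] at this
  have heq : V k x - t * Ψ k x = M * g x := by
    rw [hM, hh]; field_simp [(hgp x hxD).ne']
  have hxK : x ∉ K := by
    intro hxK
    have h1 := hK k x hxK
    have h2 : 0 < M * g x := mul_pos hMp (hgp x hxD)
    linarith
  have hc1 : ContDiffAt ℝ 2 (fun y => t * Ψ k y) x := contDiffAt_const.mul (H.Ψc k x hxD)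
  have hc2 : ContDiffAt ℝ 2 (fun y => M * g y) x := contDiffAt_const.mul (H.gc x hxD)
  have hv := H.visc k x hxD (fun y => t * Ψ k y + M * g y) (hc1.add hc2) (by
    filter_upwards [H.op.mem_nhds hxD] with z hz
    have := hall k z hz
    linarith)
  rw [lap_add hc1 hc2, lap_smul _ (H.Ψc k x hxD), lap_smul _ (H.gc x hxD)] at hv
  have hs := mul_nonneg ht (H.Ψs k x hxD)
  have hgs := H.gs x hxD hxK
  have hsum : ∑ j, J k j x * V j x - t * ∑ j, J k j x * Ψ j x ≤ Λ * (M * g x) := by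
    have hMg : 0 ≤ M * g x := (mul_pos hMp (hgp x hxD)).le
    calc ∑ j, J k j x * V j x - t * ∑ j, J k j x * Ψ j x
        = ∑ j, J k j x * (V j x - t * Ψ j x) := by
          rw [Finset.mul_sum, ← Finset.sum_sub_distrib]
          exact Finset.sum_congr rfl fun j _ => by ring
      _ ≤ ∑ j, |J k j x| * (M * g x) := by
          refine Finset.sum_le_sum fun j _ => ?_
          by_cases hjk : k = j
          · subst hjk
            rw [heq]
            exact mul_le_mul_of_nonneg_right (le_abs_self _) hMg
          · have h0 := H.coop k j hjk x hxD
            rw [abs_of_nonneg h0]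
            exact mul_le_mul_of_nonneg_left (hall j x hxD) h0
      _ = (∑ j, |J k j x|) * (M * g x) := by rw [Finset.sum_mul]
      _ ≤ Λ * (M * g x) := mul_le_mul_of_nonneg_right (H.Λb k x hxD) hMg
  have hfin : M * (lap g x + Λ * g x) < 0 := mul_neg_of_pos_of_neg hMp hgs
  nlinarith

theorem LinData.main {N m : ℕ} {D : Set (EuclN N)} {J : Fin m → Fin m → EuclN N → ℝ}
    {V Ψ : Fin m → EuclN N → ℝ} {Λ : ℝ} {g : EuclN N → ℝ} {K : Set (EuclN N)}
    (H : LinData D J V Ψ Λ g K) :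
    (∀ i, ∀ x ∈ D, V i x ≤ 0) ∨ (∀ i, ∀ x ∈ D, 0 < V i x) := by
  by_cases hneg : ∀ i, ∀ x ∈ K, V i x ≤ 0
  · left
    intro i x hx
    simpa using H.comparison le_rfl (by simpa using hneg) i x hx
  right
  push Not at hneg
  obtain ⟨i1, x1, hx1, hpos1⟩ := hneg
  have hVcD : ∀ i, ContinuousOn (V i) D := fun i => (H.Vc i).mono subset_closure
  have hΨcD : ∀ i, ContinuousOn (Ψ i) D := fun i x hx =>
    (H.Ψc i x hx).continuousAt.continuousWithinAt
  obtain ⟨k, x0, hx0, hmax⟩ := exists_max_family H.Kc ⟨x1, hx1⟩ H.hm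
    (h := fun i x => V i x / Ψ i x)
    (fun i => ((hVcD i).mono H.KD).div ((hΨcD i).mono H.KD) fun x hx => (H.Ψp i x (H.KD hx)).ne')
  set t := V k x0 / Ψ k x0 with ht
  have htp : 0 < t := lt_of_lt_of_le (div_pos hpos1 (H.Ψp i1 x1 (H.KD hx1))) (hmax i1 x1 hx1)
  have hcomp := H.comparison htp.le (fun i x hx =>
    (div_le_iff₀ (H.Ψp i x (H.KD hx))).1 (hmax i x hx))
  set w : Fin m → EuclN N → ℝ := fun i x => t * Ψ i x - V i x with hw
  have hw0 : ∀ i, ∀ x ∈ D, 0 ≤ w i x := fun i x hx => sub_nonneg.2 (hcomp i x hx)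
  have hwx0 : w k x0 = 0 := by
    simp only [hw, ht]
    rw [div_mul_cancel₀ _ (H.Ψp k x0 (H.KD hx0)).ne']; ring
  have hkey : ∀ i, ∀ x ∈ D, ∀ ψ : EuclN N → ℝ, ContDiffAt ℝ 2 ψ x →
      IsLocalMin (fun y => w i y - ψ y) x → lap ψ x ≤ - ∑ j, J i j x * w j x := by
    intro i x hx ψ hψ hmin
    have hc1 : ContDiffAt ℝ 2 (fun y => t * Ψ i y) x := contDiffAt_const.mul (H.Ψc i x hx)
    have hv := H.visc i x hx (fun y => t * Ψ i y - ψ y) (hc1.sub hψ) (by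
      filter_upwards [hmin] with z hz
      simp only [hw] at hz
      linarith)
    rw [lap_sub hc1 hψ, lap_smul _ (H.Ψc i x hx)] at hv
    have hs := mul_nonneg htp.le (H.Ψs i x hx)
    have : ∑ j, J i j x * w j x = t * ∑ j, J i j x * Ψ j x - ∑ j, J i j x * V j x := by
      rw [Finset.mul_sum, ← Finset.sum_sub_distrib]
      exact Finset.sum_congr rfl fun j _ => by simp only [hw]; ring
    rw [this]
    nlinarith
  have hdich : ∀ i, (∀ x ∈ D, w i x = 0) ∨ (∀ x ∈ D, 0 < w i x) := by
    intro i
    refine strong_max H.op H.conn H.Λ0 ((continuousOn_const.mul (hΨcD i)).sub (hVcD i)) (hw0 i) ?_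
    intro x hx ψ hψ hmin
    refine (hkey i x hx ψ hψ hmin).trans ?_
    have h1 : J i i x * w i x ≤ ∑ j, J i j x * w j x := by
      rw [← Finset.add_sum_erase _ _ (Finset.mem_univ i)]
      have : 0 ≤ ∑ j ∈ Finset.univ.erase i, J i j x * w j x :=
        Finset.sum_nonneg fun j hj =>
          mul_nonneg (H.coop i j (Finset.ne_of_mem_erase hj).symm x hx) (hw0 j x hx)
      linarith
    have h2 : |J i i x| ≤ Λ := le_trans (Finset.single_le_sum (f := fun j => |J i j x|)
      (fun j _ => abs_nonneg _) (Finset.mem_univ i)) (H.Λb i x hx)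
    have h3 := (abs_le.1 h2).1
    have h4 := hw0 i x hx
    nlinarith
  -- all components vanish
  have hallzero : ∀ i, ∀ x ∈ D, w i x = 0 := by
    classical
    by_contra hcon
    push Not at hcon
    obtain ⟨i2, x2, hx2, hne⟩ := hcon
    let I : Finset (Fin m) := Finset.univ.filter fun i => ∀ x ∈ D, w i x = 0
    let I' : Finset (Fin m) := Finset.univ.filter fun i => ¬ ∀ x ∈ D, w i x = 0
    have hk : k ∈ I := by
      simp only [I, Finset.mem_filter, Finset.mem_univ, true_and]
      rcases hdich k with h | h
      · exact h
      · have := h x0 (H.KD hx0); linarith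
    have hi2 : i2 ∈ I' := by
      simp only [I', Finset.mem_filter, Finset.mem_univ, true_and]
      exact fun h => hne (h x2 hx2)
    obtain ⟨i0, hi0, j0, hj0, x, hx, hJ⟩ := H.coup I I' ⟨k, hk⟩ ⟨i2, hi2⟩
      (Finset.disjoint_filter_filter_not _ _ _) (Finset.filter_union_filter_not_eq _ _)
    simp only [I, I', Finset.mem_filter, Finset.mem_univ, true_and] at hi0 hj0
    have hwj : 0 < w j0 x := by
      rcases hdich j0 with h | h
      · exact absurd h hj0
      · exact h x hx
    have hzero := hkey i0 x hx (fun _ => 0) contDiffAt_const (by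
      filter_upwards [H.op.mem_nhds hx] with z hz
      rw [hi0 x hx, hi0 z hz])
    have hl0 : lap (fun _ : EuclN N => (0:ℝ)) x = 0 := by
      have := lap_smul (N := N) (u := fun _ => (0:ℝ)) (x := x) 0 contDiffAt_const
      simpa using this
    rw [hl0] at hzero
    have hpos : 0 < ∑ j, J i0 j x * w j x := by
      refine Finset.sum_pos' (fun j _ => ?_) ⟨j0, Finset.mem_univ _, mul_pos hJ hwj⟩
      by_cases hij : i0 = j
      · subst hij; rw [hi0 x hx]; simp
      · exact mul_nonneg (H.coop i0 j hij x hx) (hw0 j x hx)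
    linarith
  intro i x hx
  have h1 := hallzero i x hx
  have h2 := mul_pos htp (H.Ψp i x hx)
  simp only [hw] at h1
  linarith


lemma lap_sqrt_quad {N : ℕ} {d : EuclN N → ℝ} {x : EuclN N}
    (b : Fin N → ℝ) (c : ℝ)
    (hd : ∀ (i : Fin N) (t : ℝ), d (x + t • (EuclideanSpace.single i (1:ℝ) : EuclN N)) =
      d x + b i * t + c * t ^ 2) (hdc : ContDiff ℝ 2 d) (hp : 0 < d x) :
    lap (fun y => √(d y)) x = -(∑ i, b i ^ 2) / (4 * (d x * √(d x))) + N * c / √(d x) := by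
  have h := lap_comp_quad (F := fun s => √s) (F1 := fun s => 1 / (2 * √s))
    (F2 := -1 / (4 * (d x * √(d x)))) b c hd
    (by filter_upwards [lt_mem_nhds hp] with s hs using Real.hasDerivAt_sqrt hs.ne')
    (by
      have h1 := ((Real.hasDerivAt_sqrt hp.ne').const_mul 2).fun_inv
        (by have := Real.sqrt_pos.2 hp; positivity)
      simp only [one_div]
      refine h1.congr_deriv ?_
      have hs := Real.sqrt_pos.2 hp
      have hsq := Real.sq_sqrt hp.le
      field_simp
      rw [hsq]; ring)
    (hdc.contDiffAt.sqrt hp.ne')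
  rw [h]
  have hs := Real.sqrt_pos.2 hp
  field_simp

lemma cubic_bound {n κ : ℝ} (hn : 0 ≤ n) (hκ : 0 < κ) :
    (∃ B : ℝ, 0 ≤ B ∧ ∀ s : ℝ, 0 < s → n / √s - κ / (s * √s) ≤ B) ∧
    (∀ M : ℝ, 0 ≤ M → ∃ δ : ℝ, 0 < δ ∧ ∀ s : ℝ, 0 < s → s < δ → n / √s - κ / (s * √s) < -M) := by
  have hform : ∀ s : ℝ, 0 < s → n / √s - κ / (s * √s) = n * (1 / √s) - κ * (1 / √s) ^ 3 := by
    intro s hs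
    have h1 := Real.sqrt_pos.2 hs
    have h2 := Real.sq_sqrt hs.le
    have : s * √s = √s ^ 3 := by rw [pow_succ, h2]
    rw [this]; field_simp
  set L := (n + κ) / κ with hL
  have hL1 : 1 ≤ L := by rw [hL, le_div_iff₀ hκ]; linarith
  have hLκ : κ * L = n + κ := by rw [hL]; field_simp
  constructor
  · refine ⟨n * L, by positivity, fun s hs => ?_⟩
    rw [hform s hs]
    set u := 1 / √s
    have hu : 0 < u := by have := Real.sqrt_pos.2 hs; positivity
    by_cases h : L ≤ u
    · have h1 : L ≤ u ^ 2 := by nlinarith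
      have h2 : n ≤ κ * u ^ 2 := by nlinarith
      have : n * u - κ * u ^ 3 = u * (n - κ * u ^ 2) := by ring
      have h3 : 0 ≤ n * L := by positivity
      nlinarith
    · push Not at h
      have : 0 < κ * u ^ 3 := by positivity
      nlinarith
  · intro M hM
    set U0 := L + M / κ with hU0
    have hU1 : 1 ≤ U0 := by have : 0 ≤ M / κ := by positivity
                            linarith
    have hUκ : κ * U0 = n + κ + M := by rw [hU0, mul_add, hLκ]; field_simp
    refine ⟨1 / U0 ^ 2, by positivity, fun s hs hsδ => ?_⟩
    rw [hform s hs]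
    set u := 1 / √s with hu'
    have hsp := Real.sqrt_pos.2 hs
    have hu : U0 ≤ u := by
      rw [hu', le_div_iff₀ hsp]
      have h1 : √s ≤ 1 / U0 := by
        rw [Real.sqrt_le_left (by positivity)]
        rw [div_pow, one_pow]; exact hsδ.le
      calc U0 * √s ≤ U0 * (1 / U0) := by gcongr
        _ = 1 := by field_simp
    have h1 : U0 ≤ u ^ 2 := by nlinarith
    have h2 : n + κ + M ≤ κ * u ^ 2 := by rw [← hUκ]; gcongr
    have : n * u - κ * u ^ 3 = -(u * (κ * u ^ 2 - n)) := by ring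
    rw [this]
    have : M < u * (κ * u ^ 2 - n) := by nlinarith
    linarith

lemma barrier {N : ℕ} (hN : 1 ≤ N) {R c Λ : ℝ} (hR : 0 < R) (hc : c = 1 ∨ c < 0) (hΛ : 0 ≤ Λ)
    {e : EuclN N} (he : ‖e‖ = 1) {D : Set (EuclN N)}
    (hD : ∀ x, x ∈ D ↔ 0 < ⟪x, e⟫ ∧ ‖x‖ ^ 2 < R ^ 2 ∧ 0 < ‖x‖ ^ 2 + c) :
    ∃ (g : EuclN N → ℝ) (K : Set (EuclN N)), (∀ x ∈ D, ContDiffAt ℝ 2 g x) ∧ (∀ x ∈ D, 1 ≤ g x) ∧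
      IsCompact K ∧ K ⊆ D ∧ ∀ x ∈ D, x ∉ K → lap g x + Λ * g x < 0 := by
  set d0 : EuclN N → ℝ := fun x => ⟪x, e⟫ with hd0
  set d1 : EuclN N → ℝ := fun x => R ^ 2 - ‖x‖ ^ 2 with hd1
  set d2 : EuclN N → ℝ := fun x => ‖x‖ ^ 2 + c with hd2
  have hc0 : ContDiff ℝ 2 d0 := contDiff_id.inner ℝ contDiff_const
  have hc1 : ContDiff ℝ 2 d1 := contDiff_const.sub (contDiff_id.norm_sq ℝ)
  have hc2 : ContDiff ℝ 2 d2 := (contDiff_id.norm_sq ℝ).add contDiff_const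
  have hp0 : ∀ x ∈ D, 0 < d0 x := fun x hx => ((hD x).1 hx).1
  have hp1 : ∀ x ∈ D, 0 < d1 x := fun x hx => sub_pos.2 ((hD x).1 hx).2.1
  have hp2 : ∀ x ∈ D, 0 < d2 x := fun x hx => ((hD x).1 hx).2.2
  have hnl : ∀ (x : EuclN N) (i : Fin N) (t : ℝ),
      ‖x + t • (EuclideanSpace.single i (1:ℝ) : EuclN N)‖ ^ 2 = ‖x‖ ^ 2 + (2 * x i) * t + 1 * t ^ 2 := by
    intro x i t
    simpa using norm_sq_line x 0 i t
  have hN1 : (0:ℝ) ≤ (N:ℝ) - 1 := by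
    have : (1:ℝ) ≤ N := by exact_mod_cast hN
    linarith
  -- laplacians
  have l0 : ∀ x ∈ D, lap (fun y => √(d0 y)) x = 0 / √(d0 x) - (1/4) / (d0 x * √(d0 x)) := by
    intro x hx
    rw [lap_sqrt_quad (fun i => e i) 0 (fun i t => by
      simp only [hd0, inner_add_left, real_inner_smul_left, EuclideanSpace.inner_single_left]
      simp; ring) hc0 (hp0 x hx)]
    have : ∑ i, e i ^ 2 = 1 := by
      have h := EuclideanSpace.norm_sq_eq e
      rw [he] at h
      simp only [Real.norm_eq_abs, sq_abs] at h
      linarith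
    rw [this]
    have h1 := hp0 x hx
    have := Real.sqrt_pos.2 h1
    field_simp
    ring
  have l1 : ∀ x ∈ D, lap (fun y => √(d1 y)) x ≤ 0 / √(d1 x) - R ^ 2 / (d1 x * √(d1 x)) := by
    intro x hx
    rw [lap_sqrt_quad (fun i => -(2 * x i)) (-1) (fun i t => by
      simp only [hd1, hnl]; ring) hc1 (hp1 x hx)]
    have h1 := hp1 x hx
    have hs := Real.sqrt_pos.2 h1
    simp only [neg_sq, sum_sq_coord]
    have hq : ‖x‖ ^ 2 = R ^ 2 - d1 x := by simp [hd1]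
    rw [hq]
    have : -(4 * (R ^ 2 - d1 x)) / (4 * (d1 x * √(d1 x))) + N * (-1) / √(d1 x) =
      0 / √(d1 x) - R ^ 2 / (d1 x * √(d1 x)) - (N - 1) / √(d1 x) := by
      field_simp
      ring
    rw [this]
    have : 0 ≤ ((N:ℝ) - 1) / √(d1 x) := by positivity
    linarith
  have l2 : ∀ x ∈ D, lap (fun y => √(d2 y)) x = (N - 1) / √(d2 x) - (-c) / (d2 x * √(d2 x)) := by
    intro x hx
    rw [lap_sqrt_quad (fun i => (2 * x i)) 1 (fun i t => by
      simp only [hd2, hnl]; ring) hc2 (hp2 x hx)]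
    have h1 := hp2 x hx
    have hs := Real.sqrt_pos.2 h1
    simp only [sum_sq_coord]
    have hq : ‖x‖ ^ 2 = d2 x - c := by simp [hd2]
    rw [hq]
    field_simp
    ring
  -- bounds
  obtain ⟨-, e0⟩ := cubic_bound (n := 0) (κ := 1/4) le_rfl (by norm_num)
  obtain ⟨-, e1⟩ := cubic_bound (n := 0) (κ := R ^ 2) le_rfl (by positivity)
  obtain ⟨⟨B, hB0, hB⟩, e2⟩ : (∃ B : ℝ, 0 ≤ B ∧ ∀ x ∈ D, lap (fun y => √(d2 y)) x ≤ B) ∧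
    (∀ M : ℝ, 0 ≤ M → ∃ δ : ℝ, 0 < δ ∧ ∀ x ∈ D, d2 x < δ → lap (fun y => √(d2 y)) x < -M) := by
    rcases hc with hc | hc
    · have hge : ∀ x, 1 ≤ d2 x := fun x => by simp only [hd2, hc]; nlinarith [sq_nonneg ‖x‖]
      refine ⟨⟨N, by positivity, fun x hx => ?_⟩, fun M _ => ⟨1, one_pos, fun x _ h => ?_⟩⟩
      · rw [l2 x hx, hc]
        have h1 := hge x
        have hs : 1 ≤ √(d2 x) := Real.one_le_sqrt.2 h1
        have h2 : ((N:ℝ) - 1) / √(d2 x) ≤ N - 1 := div_le_self hN1 hs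
        have h3 : 1 / (d2 x * √(d2 x)) ≤ 1 := div_le_self one_pos.le (by nlinarith)
        rw [neg_div]
        linarith
      · exact absurd h (not_lt.2 (hge x))
    · obtain ⟨⟨B, hB0, hB⟩, h2⟩ := cubic_bound hN1 (κ := -c) (by linarith)
      refine ⟨⟨B, hB0, fun x hx => ?_⟩, fun M hM => ?_⟩
      · rw [l2 x hx]; exact hB _ (hp2 x hx)
      · obtain ⟨δ, hδ, h⟩ := h2 M hM
        refine ⟨δ, hδ, fun x hx hlt => ?_⟩
        rw [l2 x hx]; exact h _ (hp2 x hx) hlt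
  set g : EuclN N → ℝ := fun x => (1 + √(d0 x)) + (√(d1 x) + √(d2 x)) with hg
  set G : ℝ := (1 + √R) + (√(R ^ 2) + √(R ^ 2 + |c|)) with hG
  have hG0 : 0 ≤ G := by positivity
  have hgG : ∀ x ∈ D, g x ≤ G := by
    intro x hx
    have h1 := ((hD x).1 hx).2.1
    have hxR : ‖x‖ < R := lt_of_pow_lt_pow_left₀ 2 hR.le h1
    have h0 : d0 x ≤ R := by
      have := real_inner_le_norm x e
      rw [he, mul_one] at this
      exact this.trans hxR.le
    have h2 : d1 x ≤ R ^ 2 := by simp only [hd1]; nlinarith [sq_nonneg ‖x‖]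
    have h3 : d2 x ≤ R ^ 2 + |c| := by simp only [hd2]; have := le_abs_self c; linarith
    simp only [hg, hG]
    gcongr
  set M := Λ * G + B with hM
  have hM0 : 0 ≤ M := by positivity
  obtain ⟨δ0, hδ0, f0⟩ := e0 M hM0
  obtain ⟨δ1, hδ1, f1⟩ := e1 M hM0
  obtain ⟨δ2, hδ2, f2⟩ := e2 M hM0
  have s0 : ∀ x ∈ D, ContDiffAt ℝ 2 (fun y => √(d0 y)) x := fun x hx =>
    hc0.contDiffAt.sqrt (hp0 x hx).ne'
  have s1 : ∀ x ∈ D, ContDiffAt ℝ 2 (fun y => √(d1 y)) x := fun x hx =>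
    hc1.contDiffAt.sqrt (hp1 x hx).ne'
  have s2 : ∀ x ∈ D, ContDiffAt ℝ 2 (fun y => √(d2 y)) x := fun x hx =>
    hc2.contDiffAt.sqrt (hp2 x hx).ne'
  have hlc : ∀ x : EuclN N, lap (fun _ : EuclN N => (1:ℝ)) x = 0 := fun x => by
    simp [lap_eq_laplacian]
  refine ⟨g, {x | δ0 ≤ d0 x ∧ δ1 ≤ d1 x ∧ δ2 ≤ d2 x}, fun x hx => ?_, fun x hx => ?_, ?_, ?_, ?_⟩
  · exact (contDiffAt_const.add (s0 x hx)).add ((s1 x hx).add (s2 x hx))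
  · simp only [hg]
    have h0 := Real.sqrt_nonneg (d0 x)
    have h1 := Real.sqrt_nonneg (d1 x)
    have h2 := Real.sqrt_nonneg (d2 x)
    linarith
  · refine (isCompact_closedBall (0 : EuclN N) R).of_isClosed_subset ?_ ?_
    · exact (isClosed_le continuous_const hc0.continuous).inter
        ((isClosed_le continuous_const hc1.continuous).inter
          (isClosed_le continuous_const hc2.continuous))
    · intro x hx
      rw [mem_closedBall_zero_iff]
      have h1 := hx.2.1
      simp only [hd1] at h1
      exact le_of_sq_le_sq (by linarith) hR.le
  · intro x hx
    have h1 := hx.2.1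
    simp only [hd1] at h1
    exact (hD x).2 ⟨hδ0.trans_le hx.1, by linarith, hδ2.trans_le hx.2.2⟩
  · intro x hx hxK
    have hlap : lap g x = lap (fun y => √(d0 y)) x + (lap (fun y => √(d1 y)) x +
        lap (fun y => √(d2 y)) x) := by
      rw [hg, lap_add (contDiffAt_const.add (s0 x hx)) ((s1 x hx).add (s2 x hx)),
        lap_add contDiffAt_const (s0 x hx), lap_add (s1 x hx) (s2 x hx), hlc, zero_add]
    have hΛg : Λ * g x ≤ Λ * G := mul_le_mul_of_nonneg_left (hgG x hx) hΛ
    have t0 : lap (fun y => √(d0 y)) x ≤ 0 := by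
      rw [l0 x hx]
      have h1 := hp0 x hx
      have : 0 ≤ (1/4) / (d0 x * √(d0 x)) := by positivity
      simpa using this
    have t1 : lap (fun y => √(d1 y)) x ≤ 0 := by
      refine (l1 x hx).trans ?_
      have h1 := hp1 x hx
      have : 0 ≤ R ^ 2 / (d1 x * √(d1 x)) := by positivity
      simpa using this
    have t2 := hB x hx
    rw [hlap]
    by_cases k0 : d0 x < δ0
    · have := f0 _ (hp0 x hx) k0
      rw [← l0 x hx] at this
      linarith
    by_cases k1 : d1 x < δ1
    · have := f1 _ (hp1 x hx) k1
      have := l1 x hx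
      linarith
    by_cases k2 : d2 x < δ2
    · have := f2 x hx k2
      linarith
    exact absurd ⟨not_lt.1 k0, not_lt.1 k1, not_lt.1 k2⟩ hxK

lemma goodDom_of {N : ℕ} {Ω : Set (EuclN N)} (h : IsBallOrAnnulus Ω) : GoodDom Ω := by
  rcases h with ⟨R, hR, rfl⟩ | ⟨r, R, hr, hrR, rfl⟩
  · refine ⟨Metric.isOpen_ball, Metric.isBounded_ball, fun x y hxy hx => ?_, ?_⟩
    · simp only [mem_ball_zero_iff] at hx ⊢; rwa [← hxy]
    · refine uniqueDiffOn_convex (convex_ball _ _).closure ?_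
      exact ⟨0, interior_mono subset_closure
        (by rw [Metric.isOpen_ball.interior_eq]; exact Metric.mem_ball_self hR)⟩
  · refine ⟨?_, ?_, fun x y hxy hx => ?_, ?_⟩
    · exact (isOpen_lt continuous_const continuous_norm).inter
        (isOpen_lt continuous_norm continuous_const)
    · refine Metric.isBounded_ball.subset (?_ : _ ⊆ Metric.ball (0 : EuclN N) R)
      intro x hx
      simpa using hx.2
    · change r < ‖y‖ ∧ ‖y‖ < R
      rw [← hxy]; exact hx
    · intro x hx
      have hx2 : r ≤ ‖x‖ ∧ ‖x‖ ≤ R := by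
        have hcl : IsClosed {x : EuclN N | r ≤ ‖x‖ ∧ ‖x‖ ≤ R} :=
          (isClosed_le continuous_const continuous_norm).inter
            (isClosed_le continuous_norm continuous_const)
        exact closure_minimal (fun y (hy : r < ‖y‖ ∧ ‖y‖ < R) =>
          (⟨hy.1.le, hy.2.le⟩ : r ≤ ‖y‖ ∧ ‖y‖ ≤ R)) hcl hx
      have hx0 : 0 < ‖x‖ := hr.trans_le hx2.1
      set c : EuclN N := ((R + r) / 2 / ‖x‖) • x with hc
      have hcn : ‖c‖ = (R + r) / 2 := by
        have hR : 0 < R := hr.trans hrR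
        rw [hc, norm_smul, Real.norm_of_nonneg (by positivity)]; field_simp
      have hρ : (0 : ℝ) < (R - r) / 2 := by linarith
      have hsub : Metric.ball c ((R - r) / 2) ⊆ {x : EuclN N | r < ‖x‖ ∧ ‖x‖ < R} := by
        intro y hy
        rw [mem_ball_iff_norm] at hy
        have h1 := norm_sub_norm_le y c
        have h2 := norm_sub_norm_le c y
        rw [norm_sub_rev] at h2
        rw [hcn] at h1 h2
        constructor <;> linarith
      have hsub2 : Metric.closedBall c ((R - r) / 2) ⊆ closure {x : EuclN N | r < ‖x‖ ∧ ‖x‖ < R} := by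
        rw [← closure_ball c hρ.ne']
        exact closure_mono hsub
      have hxm : x ∈ Metric.closedBall c ((R - r) / 2) := by
        rw [mem_closedBall_iff_norm]
        have : x - c = (1 - (R + r) / 2 / ‖x‖) • x := by rw [hc]; module
        rw [this, norm_smul, Real.norm_eq_abs]
        have : |1 - (R + r) / 2 / ‖x‖| * ‖x‖ = |‖x‖ - (R + r) / 2| := by
          rw [← abs_of_pos hx0, ← abs_mul, abs_of_pos hx0]; congr 1; field_simp
        rw [this, abs_le]
        constructor <;> linarith [hx2.1, hx2.2]
      refine UniqueDiffWithinAt.mono ?_ hsub2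
      refine uniqueDiffOn_convex (convex_closedBall _ _) ⟨c, ?_⟩ x hxm
      exact Metric.ball_subset_interior_closedBall (Metric.mem_ball_self hρ)

lemma halfDom_descr {N : ℕ} {Ω : Set (EuclN N)} (h : IsBallOrAnnulus Ω) (e : EuclN N) :
    ∃ a R c : ℝ, 0 ≤ a ∧ a < R ∧ (c = 1 ∨ c < 0) ∧
      (∀ x, x ∈ halfDom Ω e ↔ 0 < ⟪x, e⟫ ∧ ‖x‖ ^ 2 < R ^ 2 ∧ 0 < ‖x‖ ^ 2 + c) ∧
      (∀ x, x ∈ halfDom Ω e ↔ 0 < ⟪x, e⟫ ∧ a < ‖x‖ ∧ ‖x‖ < R) := by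
  rcases h with ⟨R, hR, rfl⟩ | ⟨r, R, hr, hrR, rfl⟩
  · refine ⟨0, R, 1, le_rfl, hR, Or.inl rfl, fun x => ?_, fun x => ?_⟩
    · rw [sq_lt_sq₀ (norm_nonneg _) hR.le]
      simp only [halfDom, mem_ball_zero_iff]
      exact ⟨fun h => ⟨h.2, h.1, by positivity⟩, fun h => ⟨h.2.1, h.1⟩⟩
    · simp only [halfDom, mem_ball_zero_iff]
      refine ⟨fun h => ⟨h.2, ?_, h.1⟩, fun h => ⟨h.2.2, h.1⟩⟩
      rw [norm_pos_iff]
      rintro rfl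
      simpa using h.2
  · have hR : 0 < R := hr.trans hrR
    refine ⟨r, R, -r ^ 2, hr.le, hrR, Or.inr (by simpa using pow_pos hr 2), fun x => ?_, fun x => ?_⟩
    · rw [sq_lt_sq₀ (norm_nonneg _) hR.le, ← sub_eq_add_neg, sub_pos,
        sq_lt_sq₀ hr.le (norm_nonneg _)]
      exact ⟨fun h => ⟨h.2, h.1.2, h.1.1⟩, fun h => ⟨⟨h.2.2, h.2.1⟩, h.1⟩⟩
    · exact ⟨fun h => ⟨h.2, h.1.1, h.1.2⟩, fun h => ⟨⟨h.2.1, h.2.2⟩, h.1⟩⟩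

lemma halfDom_preconn {N : ℕ} {D : Set (EuclN N)} {e : EuclN N} {a R : ℝ} (ha : 0 ≤ a)
    (hD : ∀ x, x ∈ D ↔ 0 < ⟪x, e⟫ ∧ a < ‖x‖ ∧ ‖x‖ < R) : IsPreconnected D := by
  have hpos : ∀ x : EuclN N, 0 < ⟪x, e⟫ → 0 < ‖x‖ := by
    intro x hx
    rw [norm_pos_iff]
    rintro rfl
    simp at hx
  have hconv : Convex ℝ {x : EuclN N | 0 < ⟪x, e⟫} := by
    intro x hx y hy s t hs ht hst
    change 0 < ⟪s • x + t • y, e⟫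
    change 0 < ⟪x, e⟫ at hx
    change 0 < ⟪y, e⟫ at hy
    rw [inner_add_left, real_inner_smul_left, real_inner_smul_left]
    rcases hs.eq_or_lt with rfl | hs
    · have : t = 1 := by linarith
      subst this; simpa using hy
    · have := mul_pos hs hx
      have := mul_nonneg ht hy.le
      linarith
  have hp : IsPreconnected (Ioo a R ×ˢ {x : EuclN N | 0 < ⟪x, e⟫}) :=
    ((convex_Ioo a R).prod hconv).isPreconnected
  have himg : D = (fun q : ℝ × EuclN N => (q.1 / ‖q.2‖) • q.2) ''
      (Ioo a R ×ˢ {x : EuclN N | 0 < ⟪x, e⟫}) := by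
    ext x
    rw [hD]
    constructor
    · rintro ⟨h1, h2, h3⟩
      refine ⟨(‖x‖, x), ⟨⟨h2, h3⟩, h1⟩, ?_⟩
      simp [div_self (hpos x h1).ne']
    · rintro ⟨⟨s, y⟩, ⟨⟨h1, h2⟩, h3⟩, rfl⟩
      change 0 < ⟪y, e⟫ at h3
      simp only at h1 h2 ⊢
      have hy := hpos y h3
      have hs : 0 < s := ha.trans_lt h1
      have hn : ‖(s / ‖y‖) • y‖ = s := by
        rw [norm_smul, Real.norm_of_nonneg (by positivity)]; field_simp
      rw [hn, real_inner_smul_left]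
      exact ⟨by positivity, h1, h2⟩
  rw [himg]
  refine hp.image _ ?_
  refine ContinuousOn.smul (ContinuousOn.div continuousOn_fst continuousOn_snd.norm ?_) continuousOn_snd
  rintro ⟨s, y⟩ ⟨_, h⟩
  exact (hpos y h).ne'

lemma angD_dich {N m : ℕ} (hN : 2 ≤ N) (hm : 2 ≤ m)
    {Ω : Set (EuclN N)} (hΩ : IsBallOrAnnulus Ω)
    {f : Fin m → ℝ → (Fin m → ℝ) → ℝ}
    (hf : ∀ i, ContDiff ℝ 1 (fun q : ℝ × (Fin m → ℝ) => f i q.1 q.2))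
    {U : Fin m → EuclN N → ℝ}
    (hUreg : ∀ i, ContDiffOn ℝ 2 (U i) (closure Ω))
    (hsol : IsSolution Ω f U)
    {e : EuclN N} (he : ‖e‖ = 1)
    (hcoup : FullyCoupledAlong f U (halfDom Ω e))
    (hsymm : ∀ i, ∀ x ∈ Ω, U i (reflPt e x) = U i x)
    (hprinc : ∃ Ψ : Fin m → EuclN N → ℝ,
      (∀ i, ContDiffOn ℝ 2 (Ψ i) (halfDom Ω e)) ∧
      (∀ i, ∀ x ∈ halfDom Ω e, 0 < Ψ i x) ∧
      (∀ i, ∀ x ∈ halfDom Ω e,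
        0 ≤ -lap (Ψ i) x - ∑ j, pd (f i) j ‖x‖ (fun k => U k x) * Ψ j x))
    {ν : EuclN N} (hn : ‖ν‖ = 1) (hen : ⟪e, ν⟫ = 0) :
    (∀ i, ∀ x ∈ halfDom Ω e, angD Ω U e ν i x ≤ 0) ∨
    (∀ i, ∀ x ∈ halfDom Ω e, 0 < angD Ω U e ν i x) := by
  have hG := goodDom_of hΩ
  obtain ⟨a, R, c, ha, haR, hc, hD1, hD2⟩ := halfDom_descr hΩ e
  obtain ⟨Ψ, hΨc, hΨp, hΨs⟩ := hprinc
  have hop : IsOpen (halfDom Ω e) :=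
    hG.op.inter (show IsOpen {x : EuclN N | 0 < ⟪x, e⟫} from
      isOpen_lt continuous_const (continuous_id.inner continuous_const))
  have hsub : halfDom Ω e ⊆ Ω := fun x hx => hx.1
  have hcomp : IsCompact (closure Ω) := hG.bdd.isCompact_closure
  have hb : ∀ i : Fin m, ∃ C : ℝ, ∀ x ∈ closure Ω,
      ∑ j, |pd (f i) j ‖x‖ (fun k => U k x)| ≤ C := by
    intro i
    have hcont : ContinuousOn (fun x => ∑ j, |pd (f i) j ‖x‖ (fun k => U k x)|) (closure Ω) :=
      continuousOn_finsetSum _ fun j _ =>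
        (pd_continuousOn (hf i) (fun k => (hUreg k).continuousOn) j).abs
    obtain ⟨C, hC⟩ := hcomp.exists_bound_of_continuousOn hcont
    exact ⟨C, fun x hx => (le_abs_self _).trans (hC x hx)⟩
  choose C hC using hb
  set Λ : ℝ := ∑ i, |C i| with hΛ
  have hΛ0 : 0 ≤ Λ := Finset.sum_nonneg fun i _ => abs_nonneg _
  have hΛb : ∀ i, C i ≤ Λ := fun i =>
    (le_abs_self _).trans (Finset.single_le_sum (f := fun i => |C i|) (fun i _ => abs_nonneg _)
      (Finset.mem_univ i))
  obtain ⟨g, K, hg1, hg2, hg3, hg4, hg5⟩ :=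
    barrier (by omega) (ha.trans_lt haR) hc hΛ0 he hD1
  have H : LinData (halfDom Ω e) (fun i j x => pd (f i) j ‖x‖ (fun k => U k x))
      (angD Ω U e ν) Ψ Λ g K :=
    { hm := by omega
      op := hop
      conn := halfDom_preconn ha hD2
      bdd := hG.bdd.subset hsub
      coop := fun i j hij x hx => hcoup.1 i j hij x hx _
      Vc := fun i => (angD_continuousOn hG hUreg e ν i).mono (closure_mono hsub)
      Vb := by
        intro i x hx hxD
        have hxc : x ∈ closure Ω := closure_mono hsub hx
        by_cases hxΩ : x ∈ Ω
        · have h0 : 0 ≤ ⟪x, e⟫ := by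
            have hcl : IsClosed {x : EuclN N | 0 ≤ ⟪x, e⟫} :=
              isClosed_le continuous_const (continuous_id.inner continuous_const)
            exact closure_minimal (fun y hy => hy.2.le) hcl hx
          have h1 : ¬ 0 < ⟪x, e⟫ := fun h => hxD ⟨hxΩ, h⟩
          exact angD_T hG hUreg he ν hsymm i hxΩ (le_antisymm (not_lt.1 h1) h0)
        · refine angD_frontier hG hUreg he hn hen hsol.2 i ?_
          rw [hG.op.frontier_eq]; exact ⟨hxc, hxΩ⟩
      visc := fun i x hx φ hφ hmax => angD_visc hG hf hUreg hsol.1 he hn hen i (hsub hx) hφ hmax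
      Ψc := fun i x hx => (hΨc i).contDiffAt (hop.mem_nhds hx)
      Ψp := hΨp
      Ψs := hΨs
      Λ0 := hΛ0
      Λb := fun i x hx => (hC i x (subset_closure (hsub hx))).trans (hΛb i)
      gc := hg1
      g1 := hg2
      Kc := hg3
      KD := hg4
      gs := hg5
      coup := by
        intro I J' hI hJ hd hu
        obtain ⟨i₀, hi, j₀, hj, hv⟩ := hcoup.2 I J' hI hJ hd hu
        obtain ⟨x, hx⟩ := nonempty_of_measure_ne_zero hv.ne'
        exact ⟨i₀, hi, j₀, hj, x, hx.1, hx.2⟩ }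
  exact H.main

lemma angD_neg {N m : ℕ} (Ω : Set (EuclN N)) (U : Fin m → EuclN N → ℝ) (e ν : EuclN N)
    (i : Fin m) (x : EuclN N) : angD Ω U e (-ν) i x = -angD Ω U e ν i x := by
  have : Xf e (-ν) x = -Xf e ν x := by
    simp only [Xf, inner_neg_right]; module
  rw [angD, this, map_neg, angD]

lemma rot_mono {N m : ℕ} {Ω : Set (EuclN N)} (hΩ : GoodDom Ω) {U : Fin m → EuclN N → ℝ}
    (hUreg : ∀ i, ContDiffOn ℝ 2 (U i) (closure Ω)) {e ν : EuclN N} (he : ‖e‖ = 1)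
    (hn : ‖ν‖ = 1) (hen : ⟪e, ν⟫ = 0) (i : Fin m)
    (hV : ∀ x ∈ halfDom Ω e, 0 ≤ angD Ω U e ν i x) {x : EuclN N} (hx : x ∈ Ω)
    (hxe : 0 ≤ ⟪x, e⟫) (hxn : ⟪x, ν⟫ = 0) :
    MonotoneOn (fun t => U i (rotFun e ν t x)) (Icc (-(π / 2)) (π / 2)) := by
  rcases hxe.eq_or_lt with h0 | hxe
  · have : ∀ t, rotFun e ν t x = x := by
      intro t
      simp [rotFun, Xf, hxn, ← h0]
    simp only [this]
    exact monotoneOn_const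
  · have hd : ∀ t, HasDerivAt (fun s => U i (rotFun e ν s x)) (angD Ω U e ν i (rotFun e ν t x)) t :=
      fun t => angD_hasDerivAt hΩ hUreg he hn hen i (subset_closure hx) t
    refine monotoneOn_of_deriv_nonneg (convex_Icc _ _)
      (fun t _ => (hd t).continuousAt.continuousWithinAt)
      (fun t _ => (hd t).differentiableAt.differentiableWithinAt) ?_
    intro t ht
    rw [interior_Icc] at ht
    rw [(hd t).deriv]
    refine hV _ ⟨rot_mem hΩ he hn hen t hx, ?_⟩
    rw [rotFun_inner_e he hen, hxn, mul_zero, sub_zero]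
    exact mul_pos (Real.cos_pos_of_mem_Ioo ht) hxe

lemma rot_arcsin {N : ℕ} {e ν z : EuclN N} (he : ‖e‖ = 1) (hen : ⟪e, ν⟫ = 0)
    (hze : ⟪z, e⟫ = 0) (hzn : ⟪z, ν⟫ = 0) {ρ a b : ℝ} (hρ : 0 ≤ ρ) (ha : 0 ≤ a)
    (h : a ^ 2 + b ^ 2 = ρ ^ 2) :
    rotFun e ν (Real.arcsin (b / ρ)) (z + ρ • e) = z + a • e + b • ν := by
  have hee : ⟪e, e⟫ = 1 := by rw [real_inner_self_eq_norm_sq, he]; norm_num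
  have h1 : ⟪z + ρ • e, e⟫ = ρ := by
    rw [inner_add_left, real_inner_smul_left, hze, hee]; ring
  have h2 : ⟪z + ρ • e, ν⟫ = 0 := by
    rw [inner_add_left, real_inner_smul_left, hzn, hen]; ring
  rcases hρ.eq_or_lt with rfl | hρ
  · have ha0 : a = 0 := by nlinarith
    have hb0 : b = 0 := by nlinarith
    subst ha0 hb0
    simp [rotFun_zero]
  · have hb : |b| ≤ ρ := abs_le_of_sq_le_sq (by nlinarith) hρ.le
    have hs : Real.sin (Real.arcsin (b / ρ)) = b / ρ := by
      rw [abs_le] at hb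
      refine Real.sin_arcsin ?_ ?_
      · rw [le_div_iff₀ hρ]; linarith
      · rw [div_le_iff₀ hρ]; linarith
    have hc : Real.cos (Real.arcsin (b / ρ)) = a / ρ := by
      rw [Real.cos_arcsin]
      have : 1 - (b / ρ) ^ 2 = (a / ρ) ^ 2 := by field_simp; linarith
      rw [this, Real.sqrt_sq (by positivity)]
    simp only [rotFun, Xf, h1, h2, hs, hc]
    have e1 : a / ρ * ρ = a := by field_simp
    have e2 : b / ρ * ρ = b := by field_simp
    ext k
    simp
    field_simp
    ring

lemma reflPt_facts {N : ℕ} {e : EuclN N} (he : ‖e‖ = 1) (x : EuclN N) :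
    ‖reflPt e x‖ = ‖x‖ ∧ ⟪reflPt e x, e⟫ = -⟪x, e⟫ ∧
      ∀ p : EuclN N, ⟪e, p⟫ = 0 → ⟪reflPt e x, p⟫ = ⟪x, p⟫ := by
  have hee : ⟪e, e⟫ = 1 := by rw [real_inner_self_eq_norm_sq, he]; norm_num
  refine ⟨?_, ?_, ?_⟩
  · have : ‖reflPt e x‖ ^ 2 = ‖x‖ ^ 2 := by
      rw [← real_inner_self_eq_norm_sq, ← real_inner_self_eq_norm_sq]
      simp only [reflPt, inner_sub_left, inner_sub_right, real_inner_smul_left,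
        real_inner_smul_right, hee, real_inner_comm x e]
      ring
    exact (sq_eq_sq₀ (norm_nonneg _) (norm_nonneg _)).1 this
  · simp only [reflPt, inner_sub_left, real_inner_smul_left, hee]; ring
  · intro p hp
    simp only [reflPt, inner_sub_left, real_inner_smul_left, hp]; ring

lemma reduce_meridian {N m : ℕ} {Ω : Set (EuclN N)} (hΩ : GoodDom Ω) {U : Fin m → EuclN N → ℝ}
    (hUreg : ∀ i, ContDiffOn ℝ 2 (U i) (closure Ω)) {e p : EuclN N} (he : ‖e‖ = 1)
    (hp : ‖p‖ = 1) (hep : ⟪e, p⟫ = 0) (i : Fin m)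
    (hsymm : ∀ i, ∀ x ∈ Ω, U i (reflPt e x) = U i x)
    (hV : ∀ ν : EuclN N, ‖ν‖ = 1 → ⟪e, ν⟫ = 0 → ⟪p, ν⟫ = 0 →
      ∀ x ∈ halfDom Ω e, angD Ω U e ν i x = 0) {x : EuclN N} (hx : x ∈ Ω) :
    ∃ a : ℝ, 0 ≤ a ∧ a ^ 2 + ⟪x, p⟫ ^ 2 = ‖x‖ ^ 2 ∧ U i x = U i (a • e + ⟪x, p⟫ • p) := by
  wlog hxe : 0 ≤ ⟪x, e⟫ generalizing x with H
  · obtain ⟨h1, h2, h3⟩ := reflPt_facts he x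
    have := @H (reflPt e x) (hΩ.inv x _ h1.symm hx) (by rw [h2]; linarith)
    rwa [h1, h3 p hep, hsymm i x hx] at this
  have hee : ⟪e, e⟫ = 1 := by rw [real_inner_self_eq_norm_sq, he]; norm_num
  have hpp : ⟪p, p⟫ = 1 := by rw [real_inner_self_eq_norm_sq, hp]; norm_num
  have hpe : ⟪p, e⟫ = 0 := by rw [real_inner_comm]; exact hep
  set s : ℝ := ⟪x, p⟫ with hs
  set a : ℝ := ⟪x, e⟫ with ha
  set w : EuclN N := x - s • p - a • e with hw
  have hwe : ⟪w, e⟫ = 0 := by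
    simp only [hw, inner_sub_left, real_inner_smul_left, hpe, hee]; ring_nf; simp [ha]
  have hwp : ⟪w, p⟫ = 0 := by
    simp only [hw, inner_sub_left, real_inner_smul_left, hpp, hep]; ring_nf; simp [hs]
  have hew : ⟪e, w⟫ = 0 := by rw [real_inner_comm]; exact hwe
  have hpw : ⟪p, w⟫ = 0 := by rw [real_inner_comm]; exact hwp
  have hxw : x = s • p + a • e + w := by rw [hw]; module
  have hnx : ‖x‖ ^ 2 = s ^ 2 + a ^ 2 + ‖w‖ ^ 2 := by
    rw [← real_inner_self_eq_norm_sq, ← real_inner_self_eq_norm_sq]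
    conv_lhs => rw [hxw]
    simp only [inner_add_left, inner_add_right, real_inner_smul_left, real_inner_smul_right,
      hwe, hwp, hew, hpw, hee, hpp, hpe, hep]
    ring
  clear_value w a s
  rcases eq_or_ne w 0 with hw0 | hw0
  · refine ⟨a, hxe, ?_, ?_⟩
    · rw [hnx, hw0]; simp; ring
    · conv_lhs => rw [hxw, hw0]
      congr 1; module
  · set b := ‖w‖ with hb
    have hb0 : 0 < b := norm_pos_iff.2 hw0
    set ν : EuclN N := b⁻¹ • w with hν
    have hn : ‖ν‖ = 1 := by
      rw [hν, norm_smul, Real.norm_of_nonneg (by positivity), ← hb]; field_simp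
    have hen : ⟪e, ν⟫ = 0 := by rw [hν, real_inner_smul_right, hew, mul_zero]
    have hpn : ⟪p, ν⟫ = 0 := by rw [hν, real_inner_smul_right, hpw, mul_zero]
    have hwn : w = b • ν := by rw [hν, smul_smul, mul_inv_cancel₀ hb0.ne', one_smul]
    set ρ := Real.sqrt (a ^ 2 + b ^ 2) with hρ
    have hρ0 : 0 ≤ ρ := Real.sqrt_nonneg _
    have hρ2 : a ^ 2 + b ^ 2 = ρ ^ 2 := by rw [hρ, Real.sq_sqrt (by positivity)]
    have hze : ⟪s • p, e⟫ = 0 := by rw [real_inner_smul_left, hpe, mul_zero]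
    have hzn : ⟪s • p, ν⟫ = 0 := by rw [real_inner_smul_left, hpn, mul_zero]
    have key := rot_arcsin he hen hze hzn hρ0 hxe hρ2
    rw [← hwn, ← hxw] at key
    set x0 := s • p + ρ • e with hx0
    have hx0n : ‖x0‖ = ‖x‖ := by rw [← key, rotFun_norm he hn hen]
    have hx0m : x0 ∈ Ω := hΩ.inv x _ hx0n.symm hx
    have hx0e : 0 ≤ ⟪x0, e⟫ := by
      rw [hx0, inner_add_left, hze, real_inner_smul_left, hee]; linarith
    have hx0v : ⟪x0, ν⟫ = 0 := by
      rw [hx0, inner_add_left, hzn, real_inner_smul_left, hen]; ring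
    refine ⟨ρ, hρ0, by rw [← hρ2, hnx]; ring, ?_⟩
    have hd : ∀ t, HasDerivAt (fun s => U i (rotFun e ν s x0)) (angD Ω U e ν i (rotFun e ν t x0)) t :=
      fun t => angD_hasDerivAt hΩ hUreg he hn hen i (subset_closure hx0m) t
    have m1 := rot_mono hΩ hUreg he hn hen i (fun y hy => (hV ν hn hen hpn y hy).ge) hx0m hx0e hx0v
    have hanti : AntitoneOn (fun t => U i (rotFun e ν t x0)) (Icc (-(π / 2)) (π / 2)) := by
      have m2 := rot_mono (U := fun i x => - U i x) hΩ (fun i => (hUreg i).neg) he hn hen i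
        (fun y hy => by
          have : angD Ω (fun i x => - U i x) e ν i y = - angD Ω U e ν i y := by
            unfold angD
            rw [fderivWithin_fun_neg (hΩ.ud y (subset_closure hy.1))]; simp
          rw [this, hV ν hn hen hpn y hy, neg_zero]) hx0m hx0e hx0v
      intro t ht t' ht' htt
      have := m2 ht ht' htt
      simp only at this ⊢
      linarith
    have hA : Real.arcsin (b / ρ) ∈ Icc (-(π / 2)) (π / 2) :=
      ⟨Real.neg_pi_div_two_le_arcsin _, Real.arcsin_le_pi_div_two _⟩
    have h0 : (0 : ℝ) ∈ Icc (-(π / 2)) (π / 2) := by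
      constructor <;> linarith [Real.pi_pos]
    have h0A : 0 ≤ Real.arcsin (b / ρ) := Real.arcsin_nonneg.2 (by positivity)
    have q1 := m1 h0 hA h0A
    have q2 := hanti h0 hA h0A
    simp only [key, rotFun_zero] at q1 q2
    rw [add_comm (ρ • e), ← hx0]
    exact le_antisymm q2 q1

lemma foliated_of_angD {N m : ℕ} {Ω : Set (EuclN N)} (hΩ : GoodDom Ω) {U : Fin m → EuclN N → ℝ}
    (hUreg : ∀ i, ContDiffOn ℝ 2 (U i) (closure Ω)) {e p : EuclN N} (he : ‖e‖ = 1)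
    (hp : ‖p‖ = 1) (hep : ⟪e, p⟫ = 0)
    (hsymm : ∀ i, ∀ x ∈ Ω, U i (reflPt e x) = U i x)
    (hV : ∀ i, ∀ ν : EuclN N, ‖ν‖ = 1 → ⟪e, ν⟫ = 0 → ⟪p, ν⟫ = 0 →
      ∀ x ∈ halfDom Ω e, angD Ω U e ν i x = 0)
    (hVp : ∀ i, ∀ x ∈ halfDom Ω e, 0 ≤ angD Ω U e p i x) : FoliatedSchwarzWith Ω U p := by
  refine ⟨hp, fun i x hx y hy hxy hle => ?_⟩
  obtain ⟨a, ha0, ha, hUa⟩ := reduce_meridian hΩ hUreg he hp hep i hsymm (hV i) hx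
  obtain ⟨b, hb0, hb, hUb⟩ := reduce_meridian hΩ hUreg he hp hep i hsymm (hV i) hy
  rw [hUa, hUb]
  rw [← hxy] at hb
  have k1 := rot_arcsin (z := 0) he hep (by simp) (by simp) (norm_nonneg x) ha0 ha
  have k2 := rot_arcsin (z := 0) he hep (by simp) (by simp) (norm_nonneg x) hb0 hb
  simp only [zero_add] at k1 k2
  rw [← k1, ← k2]
  have hee : ⟪e, e⟫ = 1 := by rw [real_inner_self_eq_norm_sq, he]; norm_num
  have hm : ‖x‖ • e ∈ Ω := hΩ.inv x _ (by rw [norm_smul, he]; simp) hx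
  refine rot_mono hΩ hUreg he hp hep i (hVp i) hm
    (by rw [real_inner_smul_left, hee]; positivity) (by rw [real_inner_smul_left, hep, mul_zero])
    ⟨Real.neg_pi_div_two_le_arcsin _, Real.arcsin_le_pi_div_two _⟩
    ⟨Real.neg_pi_div_two_le_arcsin _, Real.arcsin_le_pi_div_two _⟩ ?_
  exact Real.monotone_arcsin (by gcongr)

lemma exists_unit_perp {N : ℕ} (hN : 2 ≤ N) (e : EuclN N) : ∃ p : EuclN N, ‖p‖ = 1 ∧ ⟪e, p⟫ = 0 := by
  have h : (ℝ ∙ e)ᗮ ≠ ⊥ := by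
    intro h
    rw [Submodule.orthogonal_eq_bot_iff] at h
    have h1 := finrank_span_le_card (R := ℝ) ({e} : Set (EuclN N))
    rw [h] at h1
    simp at h1
    omega
  obtain ⟨v, hv, hv0⟩ := Submodule.exists_mem_ne_zero_of_ne_bot h
  have hev : ⟪e, v⟫ = 0 := Submodule.mem_orthogonal_singleton_iff_inner_right.1 hv
  refine ⟨‖v‖⁻¹ • v, ?_, ?_⟩
  · rw [norm_smul, norm_inv, norm_norm, inv_mul_cancel₀ (norm_ne_zero_iff.2 hv0)]
  · rw [real_inner_smul_right, hev, mul_zero]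

/-- Choice of the axis. -/
lemma exists_axis {N : ℕ} (hN : 2 ≤ N) {e : EuclN N} (he : ‖e‖ = 1) (L : EuclN N →L[ℝ] ℝ)
    (x : EuclN N) : ∃ p : EuclN N, ‖p‖ = 1 ∧ ⟪e, p⟫ = 0 ∧ 0 ≤ L (Xf e p x) ∧
      ∀ ν : EuclN N, ⟪e, ν⟫ = 0 → ⟪p, ν⟫ = 0 → L (Xf e ν x) = 0 := by
  have hee : ⟪e, e⟫ = 1 := by rw [real_inner_self_eq_norm_sq, he]; norm_num
  set q : EuclN N := (InnerProductSpace.toDual ℝ (EuclN N)).symm L with hq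
  have hL : ∀ v, L v = ⟪q, v⟫ := fun v => by rw [hq, InnerProductSpace.toDual_symm_apply]
  set w0 : EuclN N := ⟪x, e⟫ • q - ⟪q, e⟫ • x with hw0
  have hLX : ∀ ν, L (Xf e ν x) = ⟪w0, ν⟫ := by
    intro ν
    rw [hL, Xf, hw0, inner_sub_right, inner_sub_left]
    simp only [real_inner_smul_left, real_inner_smul_right]
    ring
  set w : EuclN N := w0 - ⟪w0, e⟫ • e with hw
  have hwe : ⟪e, w⟫ = 0 := by
    rw [real_inner_comm, hw, inner_sub_left, real_inner_smul_left, hee]; ring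
  have hwn : ∀ ν, ⟪e, ν⟫ = 0 → L (Xf e ν x) = ⟪w, ν⟫ := by
    intro ν h
    rw [hLX, hw, inner_sub_left w0, real_inner_smul_left, h]; ring
  rcases eq_or_ne w 0 with h0 | h0
  · obtain ⟨p, hp, hep⟩ := exists_unit_perp hN e
    refine ⟨p, hp, hep, ?_, fun ν h _ => ?_⟩
    · rw [hwn p hep, h0, inner_zero_left]
    · rw [hwn ν h, h0, inner_zero_left]
  · have hep : ⟪e, ‖w‖⁻¹ • w⟫ = 0 := by rw [real_inner_smul_right, hwe, mul_zero]
    refine ⟨‖w‖⁻¹ • w, ?_, hep, ?_, fun ν h h2 => ?_⟩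
    · rw [norm_smul, norm_inv, norm_norm, inv_mul_cancel₀ (norm_ne_zero_iff.2 h0)]
    · rw [hwn _ hep, real_inner_smul_right, real_inner_self_eq_norm_sq]; positivity
    · rw [hwn ν h]
      rw [real_inner_smul_left] at h2
      exact (mul_eq_zero.1 h2).resolve_left (inv_ne_zero (norm_ne_zero_iff.2 h0))

theorem main17
    {N m : ℕ} (hN : 2 ≤ N) (hm : 2 ≤ m)
    (Ω : Set (EuclN N)) (hΩ : IsBallOrAnnulus Ω)
    (f : Fin m → ℝ → (Fin m → ℝ) → ℝ)
    (hf : ∀ i, ContDiff ℝ 1 (fun q : ℝ × (Fin m → ℝ) => f i q.1 q.2))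
    (U : Fin m → EuclN N → ℝ)
    (hUreg : ∀ i, ContDiffOn ℝ 2 (U i) (closure Ω))
    (hsol : IsSolution Ω f U)
    (hcoup : ∀ e' : EuclN N, ‖e'‖ = 1 → FullyCoupledAlong f U (halfDom Ω e'))
    (e : EuclN N) (he : ‖e‖ = 1)
    (hsymm : ∀ i, ∀ x ∈ Ω, U i (reflPt e x) = U i x)
    (hprinc : ∃ Ψ : Fin m → EuclN N → ℝ,
      (∀ i, ContDiffOn ℝ 2 (Ψ i) (halfDom Ω e)) ∧
      (∀ i, ∀ x ∈ halfDom Ω e, 0 < Ψ i x) ∧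
      (∀ i, ∀ x ∈ halfDom Ω e,
        0 ≤ -lap (Ψ i) x - ∑ j, pd (f i) j ‖x‖ (fun k => U k x) * Ψ j x)) :
    FoliatedSchwarz Ω U := by
  have hG := goodDom_of hΩ
  have hdich : ∀ ν : EuclN N, ‖ν‖ = 1 → ⟪e, ν⟫ = 0 →
      (∀ i, ∀ x ∈ halfDom Ω e, angD Ω U e ν i x ≤ 0) ∨
      (∀ i, ∀ x ∈ halfDom Ω e, 0 < angD Ω U e ν i x) := fun ν hn hen =>
    angD_dich hN hm hΩ hf hUreg hsol he (hcoup e he) hsymm hprinc hn hen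
  have hdich2 : ∀ ν : EuclN N, ‖ν‖ = 1 → ⟪e, ν⟫ = 0 →
      (∀ i, ∀ x ∈ halfDom Ω e, 0 ≤ angD Ω U e ν i x) ∨
      (∀ i, ∀ x ∈ halfDom Ω e, angD Ω U e ν i x < 0) := by
    intro ν hn hen
    have := hdich (-ν) (by rwa [norm_neg]) (by rw [inner_neg_right, hen, neg_zero])
    simpa only [angD_neg, Left.neg_nonpos_iff, Left.neg_pos_iff] using this
  obtain ⟨a, R, c, ha, haR, hc, hD1, hD2⟩ := halfDom_descr hΩ e
  have hee : ⟪e, e⟫ = 1 := by rw [real_inner_self_eq_norm_sq, he]; norm_num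
  obtain ⟨x0, hx0⟩ : ∃ x0, x0 ∈ halfDom Ω e := by
    refine ⟨((a + R) / 2) • e, (hD2 _).2 ?_⟩
    rw [real_inner_smul_left, hee, norm_smul, he, Real.norm_of_nonneg (by linarith)]
    refine ⟨by linarith, by linarith, by linarith⟩
  have i0 : Fin m := ⟨0, by omega⟩
  obtain ⟨p, hp, hep, hLp, hLν⟩ := exists_axis hN he (fderiv ℝ (U i0) x0) x0
  refine ⟨p, foliated_of_angD hG hUreg he hp hep hsymm ?_ ?_⟩
  · intro i ν hn hen hpn x hx
    have h0 : angD Ω U e ν i0 x0 = 0 := by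
      rw [angD_eq_fderiv hG i0 hx0.1]; exact hLν ν hen hpn
    rcases hdich ν hn hen with h1 | h1
    · rcases hdich2 ν hn hen with h2 | h2
      · exact le_antisymm (h1 i x hx) (h2 i x hx)
      · exact absurd h0 (h2 i0 x0 hx0).ne
    · exact absurd h0 (h1 i0 x0 hx0).ne'
  · rcases hdich2 p hp hep with h2 | h2
    · exact h2
    · exfalso
      have := h2 i0 x0 hx0
      rw [angD_eq_fderiv hG i0 hx0.1] at this
      linarith

end

/-- **A symmetry hyperplane with nonnegative principal eigenvalue of the linearized operator
in the half-domain implies foliated Schwarz symmetry.** -/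
theorem statement17
    {N m : ℕ} (hN : 2 ≤ N) (hm : 2 ≤ m)
    (Ω : Set (EuclN N)) (hΩ : IsBallOrAnnulus Ω)
    (f : Fin m → ℝ → (Fin m → ℝ) → ℝ)
    (hf : ∀ i, ContDiff ℝ 1 (fun q : ℝ × (Fin m → ℝ) => f i q.1 q.2))
    (U : Fin m → EuclN N → ℝ)
    (hUreg : ∀ i, ContDiffOn ℝ 2 (U i) (closure Ω))
    (hsol : IsSolution Ω f U)
    (hcoup : ∀ e' : EuclN N, ‖e'‖ = 1 → FullyCoupledAlong f U (halfDom Ω e'))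
    (e : EuclN N) (he : ‖e‖ = 1)
    (hsymm : ∀ i, ∀ x ∈ Ω, U i (reflPt e x) = U i x)
    (hprinc : ∃ Ψ : Fin m → EuclN N → ℝ,
      (∀ i, ContDiffOn ℝ 2 (Ψ i) (halfDom Ω e)) ∧
      (∀ i, ∀ x ∈ halfDom Ω e, 0 < Ψ i x) ∧
      (∀ i, ∀ x ∈ halfDom Ω e,
        0 ≤ -lap (Ψ i) x - ∑ j, pd (f i) j ‖x‖ (fun k => U k x) * Ψ j x)) :
    FoliatedSchwarz Ω U := by
  exact main17 hN hm Ω hΩ f hf U hUreg hsol hcoup e he hsymm hprinc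
end

section
/- (Nonpositivity of the linearized quadratic form on the positive part of the reflected difference.) Let Ω be an open ball or annulus centered at the origin in ℝ^N, N ≥ 2, and let U ∈ C²(Ω̄;ℝ^m) solve −Δu_i = f_i(|x|,U) in Ω, u_i = 0 on ∂Ω, where F satisfies: (i) the system is fully coupled along U in Ω(e) for every e ∈ S^{N−1}; (ii) each (∂f_i/∂u_j)(|x|,u_1,…,u_m) is nondecreasing in each variable u_k; (iii) if m ≥ 3, each f_i(|x|,u_1,…,u_m) = Σ_{k≠i} g_{ik}(|x|,u_i,u_k) with g_{ik} ∈ C^{1,α}. Then for every direction e ∈ S^{N−1}, the positive part (W^e)⁺ = ((u_1 − u_1^{σ_e})⁺, …, (u_m − u_m^{σ_e})⁺) satisfies Q_U((W^e)⁺; Ω(e)) ≤ 0. -/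
open MeasureTheory Real Set
open scoped RealInnerProductSpace ENNReal

open Filter Topology

/-! ### The truncation -/

lemma aux_sq_deriv (t : ℝ) : HasDerivAt (fun t : ℝ => (max t 0) ^ 2) (2 * max t 0) t := by
  rcases lt_trichotomy t 0 with h | h | h
  · have : (fun t : ℝ => (max t 0) ^ 2) =ᶠ[𝓝 t] fun _ => 0 := by
      filter_upwards [Iio_mem_nhds h] with s hs
      simp [max_eq_right (le_of_lt (mem_Iio.1 hs))]
    rw [max_eq_right h.le, mul_zero]
    exact (hasDerivAt_const t (0:ℝ)).congr_of_eventuallyEq this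
  · subst h
    rw [hasDerivAt_iff_isLittleO]
    simp only [max_self, mul_zero, smul_zero, sub_zero, ne_eq, OfNat.ofNat_ne_zero,
      not_false_eq_true, zero_pow]
    have h1 : (fun x : ℝ => max x 0 ^ 2) =O[𝓝 0] fun x : ℝ => x ^ 2 := by
      refine Asymptotics.IsBigO.of_bound 1 (Eventually.of_forall fun x => ?_)
      simp only [norm_pow, one_mul]
      gcongr
      rcases le_total x 0 with h | h <;> simp [h]
    refine h1.trans_isLittleO ?_
    exact Asymptotics.isLittleO_pow_id (by norm_num)
  · have : (fun t : ℝ => (max t 0) ^ 2) =ᶠ[𝓝 t] fun t => t ^ 2 := by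
      filter_upwards [Ioi_mem_nhds h] with s hs
      simp [max_eq_left (le_of_lt (mem_Ioi.1 hs))]
    rw [max_eq_left h.le]
    simpa using (hasDerivAt_pow 2 t).congr_of_eventuallyEq this

noncomputable def phiT (ε t : ℝ) : ℝ := √((max (t - ε) 0) ^ 2 + ε ^ 2) - ε
noncomputable def phiD (ε t : ℝ) : ℝ := max (t - ε) 0 / √((max (t - ε) 0) ^ 2 + ε ^ 2)

lemma phiT_hasDeriv {ε : ℝ} (hε : 0 < ε) (t : ℝ) : HasDerivAt (phiT ε) (phiD ε t) t := by
  have h1 : HasDerivAt (fun t : ℝ => (max (t - ε) 0) ^ 2) (2 * max (t - ε) 0) t := by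
    have := (aux_sq_deriv (t - ε)).comp t ((hasDerivAt_id t).sub_const ε)
    simpa [Function.comp_def] using this
  have h2 := ((h1.add_const (ε ^ 2)).sqrt (by positivity)).sub_const ε
  refine h2.congr_deriv ?_
  unfold phiD
  rw [mul_div_mul_left _ _ (by norm_num)]

lemma phiD_cont {ε : ℝ} (hε : 0 < ε) : Continuous (phiD ε) := by
  unfold phiD
  refine Continuous.div (by fun_prop) (by fun_prop) fun t => ?_
  positivity

lemma phiT_contDiff {ε : ℝ} (hε : 0 < ε) : ContDiff ℝ 1 (phiT ε) := by
  rw [contDiff_one_iff_deriv]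
  refine ⟨fun t => (phiT_hasDeriv hε t).differentiableAt, ?_⟩
  have : deriv (phiT ε) = phiD ε := funext fun t => (phiT_hasDeriv hε t).deriv
  rw [this]; exact phiD_cont hε

lemma phiT_zero {ε t : ℝ} (hε : 0 < ε) (h : t ≤ ε) : phiT ε t = 0 := by
  simp [phiT, max_eq_right (sub_nonpos.2 h), Real.sqrt_sq hε.le]

lemma phiD_zero {ε t : ℝ} (h : t ≤ ε) : phiD ε t = 0 := by
  simp [phiD, max_eq_right (sub_nonpos.2 h)]

lemma phiD_nonneg (ε t : ℝ) : 0 ≤ phiD ε t := by unfold phiD; positivity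

lemma phiD_le (ε t : ℝ) : phiD ε t ≤ 1 := by
  unfold phiD
  refine div_le_one_of_le₀ ?_ (by positivity)
  exact Real.le_sqrt_of_sq_le (by nlinarith [sq_nonneg ε])

lemma phiT_nonneg {ε : ℝ} (t : ℝ) : 0 ≤ phiT ε t := by
  unfold phiT
  rw [sub_nonneg]
  exact Real.le_sqrt_of_sq_le (by nlinarith [sq_nonneg (max (t - ε) 0)])

lemma phiT_le {ε : ℝ} (hε : 0 < ε) (t : ℝ) : phiT ε t ≤ max t 0 := by
  unfold phiT
  have h0 : 0 ≤ max (t - ε) 0 := le_max_right _ _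
  have h1 : √((max (t - ε) 0) ^ 2 + ε ^ 2) ≤ max (t - ε) 0 + ε := by
    rw [Real.sqrt_le_left (by positivity)]
    nlinarith
  have h2 : max (t - ε) 0 ≤ max t 0 := max_le_max (by linarith) le_rfl
  linarith

lemma phiT_tendsto {s : ℕ → ℝ} (hs : Tendsto s atTop (𝓝 0)) (t : ℝ) :
    Tendsto (fun n => phiT (s n) t) atTop (𝓝 (max t 0)) := by
  have hc : Continuous fun ε : ℝ => phiT ε t := by unfold phiT; fun_prop
  have := (hc.tendsto 0).comp hs
  simpa [phiT, Function.comp_def, Real.sqrt_sq (le_max_right t 0)] using this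

lemma phiD_tendsto {s : ℕ → ℝ} (hs : Tendsto s atTop (𝓝 0)) (hp : ∀ n, 0 < s n) (t : ℝ) :
    Tendsto (fun n => phiD (s n) t) atTop (𝓝 (if 0 < t then 1 else 0)) := by
  split_ifs with h
  · have hc : ContinuousAt (fun ε : ℝ => phiD ε t) 0 := by
      unfold phiD
      refine ContinuousAt.div (by fun_prop) (by fun_prop) ?_
      simp [h.le, Real.sqrt_sq h.le, h.ne']
    have := hc.tendsto.comp hs
    simpa [phiD, Function.comp_def, h.le, Real.sqrt_sq h.le, h.ne'] using this
  · have : ∀ n, phiD (s n) t = 0 := fun n => phiD_zero (by linarith [hp n])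
    simp [this]

/-! ### pointwise inequality -/

lemma aux_fderiv_sum {m : ℕ} (F : ℝ → (Fin m → ℝ) → ℝ) (r : ℝ) (z d : Fin m → ℝ) :
    fderiv ℝ (F r) z d = ∑ j, d j * pd F j r z := by
  conv_lhs => rw [← Finset.univ_sum_single d]
  rw [map_sum]
  refine Finset.sum_congr rfl fun j _ => ?_
  have : (Pi.single j (d j) : Fin m → ℝ) = d j • Pi.single j (1:ℝ) := by
    rw [← Pi.single_smul]; simp
  rw [this, map_smul]; rfl

lemma aux_mvt {m : ℕ} (F : ℝ → (Fin m → ℝ) → ℝ) (r : ℝ) (hF : Differentiable ℝ (F r))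
    (s t : Fin m → ℝ) :
    ∃ z ∈ segment ℝ s t, F r t - F r s = ∑ j, (t j - s j) * pd F j r z := by
  obtain ⟨z, hz, h⟩ := domain_mvt (f := F r) (f' := fderiv ℝ (F r)) (s := univ) (x := s) (y := t)
    (fun x _ => (hF x).hasFDerivAt.hasFDerivWithinAt) convex_univ (mem_univ _) (mem_univ _)
  exact ⟨z, hz, by rw [h, aux_fderiv_sum]; rfl⟩

lemma pointwise_ineq {m : ℕ} (F : ℝ → (Fin m → ℝ) → ℝ) (r : ℝ) (hF : Differentiable ℝ (F r))
    (i : Fin m) (hco : ∀ j, i ≠ j → ∀ s, 0 ≤ pd F j r s)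
    (hmono : ∀ j (s t : Fin m → ℝ), (∀ k, s k ≤ t k) → pd F j r s ≤ pd F j r t)
    (u v : Fin m → ℝ) :
    (F r u - F r v) * max (u i - v i) 0 ≤
      ∑ j, pd F j r u * max (u i - v i) 0 * max (u j - v j) 0 := by
  rcases le_or_gt (u i) (v i) with h | h
  · simp [h]
  have key : F r u - F r v ≤ ∑ j, pd F j r u * max (u j - v j) 0 := by
    obtain ⟨z, hz, h1⟩ := aux_mvt F r hF (u ⊓ v) u
    obtain ⟨z', hz', h2⟩ := aux_mvt F r hF (u ⊓ v) v
    have hzu : z ≤ u := by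
      have := segment_subset_Icc (𝕜 := ℝ) (inf_le_left : u ⊓ v ≤ u) hz
      exact this.2
    have e1 : F r u - F r (u ⊓ v) ≤ ∑ j, pd F j r u * max (u j - v j) 0 := by
      rw [h1]
      refine Finset.sum_le_sum fun j _ => ?_
      have : u j - (u ⊓ v) j = max (u j - v j) 0 := by
        simp only [Pi.inf_apply]
        rcases le_total (u j) (v j) with h | h <;> simp [h]
      rw [this, mul_comm]
      exact mul_le_mul_of_nonneg_right (hmono j z u hzu) (le_max_right _ _)
    have e2 : 0 ≤ F r v - F r (u ⊓ v) := by
      rw [h2]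
      refine Finset.sum_nonneg fun j _ => ?_
      by_cases hj : i = j
      · subst hj; simp [h.le]
      · exact mul_nonneg (by simp) (hco j hj z')
    linarith
  have := mul_le_mul_of_nonneg_right key (le_max_right (u i - v i) 0)
  rw [Finset.sum_mul] at this
  refine this.trans (le_of_eq (Finset.sum_congr rfl fun j _ => by ring))

/-! ### Laplacian -/

lemma lap_eq {N : ℕ} (u : EuclN N → ℝ) (x : EuclN N) : lap u x = Laplacian.laplacian u x := by
  rw [InnerProductSpace.laplacian_eq_iteratedFDeriv_orthonormalBasis u
    (EuclideanSpace.basisFun (Fin N) ℝ)]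
  simp [lap]

lemma lap_comp {N : ℕ} (g : EuclN N ≃ₗᵢ[ℝ] EuclN N) (u : EuclN N → ℝ) (x : EuclN N) :
    lap (fun y => u (g y)) x = lap u (g x) := by
  rw [lap_eq u, InnerProductSpace.laplacian_eq_iteratedFDeriv_orthonormalBasis u
    ((EuclideanSpace.basisFun (Fin N) ℝ).map g)]
  unfold lap
  refine Finset.sum_congr rfl fun i _ => ?_
  have h := g.toContinuousLinearEquiv.iteratedFDerivWithin_comp_right u uniqueDiffOn_univ
    (x := x) (mem_univ _) 2
  simp only [preimage_univ, iteratedFDerivWithin_univ] at h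
  have h' : (fun y => u (g y)) = u ∘ g.toContinuousLinearEquiv := rfl
  rw [h', h]
  simp only [ContinuousMultilinearMap.compContinuousLinearMap_apply]
  congr 1
  ext k
  fin_cases k <;> simp

lemma lap_eq_fderiv {N : ℕ} (u : EuclN N → ℝ) (x : EuclN N) (hu : ContDiffAt ℝ 2 u x) :
    lap u x = ∑ i, fderiv ℝ (fun y => fderiv ℝ u y (EuclideanSpace.single i 1)) x
      (EuclideanSpace.single i 1) := by
  unfold lap
  refine Finset.sum_congr rfl fun i _ => ?_
  have hd : DifferentiableAt ℝ (fderiv ℝ u) x :=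
    (hu.fderiv_right (m := 1) (by norm_num)).differentiableAt (by norm_num)
  rw [iteratedFDeriv_two_apply, fderiv_clm_apply hd (by fun_prop)]
  simp

lemma grad_norm_sq {N : ℕ} (u : EuclN N → ℝ) (x : EuclN N) :
    ‖gradient u x‖ ^ 2 = ∑ i, (fderiv ℝ u x (EuclideanSpace.single i 1)) ^ 2 := by
  rw [EuclideanSpace.norm_sq_eq]
  refine Finset.sum_congr rfl fun i _ => ?_
  have h : fderiv ℝ u x (EuclideanSpace.single i 1) =
      ⟪gradient u x, EuclideanSpace.single i (1:ℝ)⟫ := by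
    rw [← InnerProductSpace.toDual_apply_apply (𝕜 := ℝ), toDual_gradient]
  rw [h, EuclideanSpace.inner_single_right]
  simp

/-! ### integration by parts -/

lemma integral_fderiv_zero {N : ℕ} {v : EuclN N → ℝ} (hv : ContDiff ℝ 1 v)
    (hc : HasCompactSupport v) (d : EuclN N) :
    Integrable (fun x => fderiv ℝ v x d) ∧ ∫ x, fderiv ℝ v x d = 0 := by
  have hcont : Continuous (fun x => fderiv ℝ v x d) :=
    (hv.continuous_fderiv (by norm_num)).clm_apply continuous_const
  have hi : Integrable (fun x => fderiv ℝ v x d) :=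
    hcont.integrable_of_hasCompactSupport (hc.fderiv_apply (𝕜 := ℝ) d)
  refine ⟨hi, ?_⟩
  have hvi : Integrable v := hv.continuous.integrable_of_hasCompactSupport hc
  have := integral_mul_fderiv_eq_neg_fderiv_mul_of_integrable (μ := (volume : Measure (EuclN N)))
    (f := v) (g := fun _ => (1:ℝ)) (v := d)
    (by simpa using hi) (by simp) (by simpa using hvi)
    (fun x _ => hv.differentiable (by norm_num) x) (fun x _ => differentiableAt_const _)
  simpa using this.symm

lemma ibp_eps {N : ℕ} {O : Set (EuclN N)} (hO : IsOpen O) {w : EuclN N → ℝ}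
    (hw : ContDiffOn ℝ 2 w O) {ε : ℝ} (hε : 0 < ε) (hK : IsCompact {x ∈ O | ε ≤ w x}) :
    ∫ x in O, (phiD ε (w x) * ‖gradient w x‖ ^ 2 + phiT ε (w x) * lap w x) = 0 := by
  classical
  set K := {x ∈ O | ε ≤ w x} with hKdef
  have hwa : ∀ x ∈ O, ContDiffAt ℝ 2 w x := fun x hx => hw.contDiffAt (hO.mem_nhds hx)
  let b : Fin N → EuclN N := fun i => EuclideanSpace.single i 1
  let v : Fin N → EuclN N → ℝ := fun i => O.indicator fun x => phiT ε (w x) * fderiv ℝ w x (b i)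
  have hvK : ∀ i, ∀ x ∉ K, v i x = 0 := by
    intro i x hx
    by_cases hxO : x ∈ O
    · have : w x ≤ ε := by
        by_contra h
        exact hx ⟨hxO, (not_le.1 h).le⟩
      simp [v, hxO, phiT_zero hε this]
    · simp [v, hxO]
  have hveq : ∀ i, ∀ x ∈ O, v i =ᶠ[𝓝 x] fun x => phiT ε (w x) * fderiv ℝ w x (b i) := by
    intro i x hx
    filter_upwards [hO.mem_nhds hx] with y hy
    simp [v, hy]
  have hveq0 : ∀ i, ∀ x ∉ K, v i =ᶠ[𝓝 x] fun _ => 0 := by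
    intro i x hx
    filter_upwards [hK.isClosed.isOpen_compl.mem_nhds hx] with y hy
    exact hvK i y hy
  have hKO : K ⊆ O := fun x hx => hx.1
  have hfd : ∀ x ∈ O, ContDiffAt ℝ 1 (fderiv ℝ w) x := fun x hx =>
    (hwa x hx).fderiv_right (m := 1) (by norm_num)
  have hphi : ∀ x ∈ O, ContDiffAt ℝ 1 (fun y => phiT ε (w y)) x := fun x hx =>
    (phiT_contDiff hε).contDiffAt.comp x ((hwa x hx).of_le (by norm_num))
  have hdi : ∀ i, ∀ x ∈ O, ContDiffAt ℝ 1 (fun y => fderiv ℝ w y (b i)) x := fun i x hx =>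
    (hfd x hx).clm_apply contDiffAt_const
  have hvC : ∀ i, ContDiff ℝ 1 (v i) := by
    intro i
    rw [contDiff_iff_contDiffAt]
    intro x
    by_cases hx : x ∈ K
    · exact ((hphi x (hKO hx)).mul (hdi i x (hKO hx))).congr_of_eventuallyEq (hveq i x (hKO hx))
    · exact contDiffAt_const.congr_of_eventuallyEq (hveq0 i x hx)
  have hvS : ∀ i, HasCompactSupport (v i) := fun i => HasCompactSupport.intro hK (hvK i)
  have hint := fun i => integral_fderiv_zero (hvC i) (hvS i) (b i)
  have hsum : ∫ x, ∑ i, fderiv ℝ (v i) x (b i) = 0 := by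
    rw [integral_finsetSum _ fun i _ => (hint i).1]
    exact Finset.sum_eq_zero fun i _ => (hint i).2
  rw [← hsum, ← integral_indicator hO.measurableSet]
  congr 1
  ext x
  by_cases hx : x ∈ O
  · rw [indicator_of_mem hx]
    have hder : ∀ i, fderiv ℝ (v i) x (b i) = phiD ε (w x) * (fderiv ℝ w x (b i)) ^ 2 +
        phiT ε (w x) * fderiv ℝ (fun y => fderiv ℝ w y (b i)) x (b i) := by
      intro i
      rw [(hveq i x hx).fderiv_eq]
      have h1 : HasFDerivAt (fun y => phiT ε (w y)) (phiD ε (w x) • fderiv ℝ w x) x :=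
        (phiT_hasDeriv hε (w x)).comp_hasFDerivAt x
          ((hwa x hx).differentiableAt (by norm_num)).hasFDerivAt
      have h2 := ((hdi i x hx).differentiableAt (by norm_num)).hasFDerivAt
      have h3 := (h1.mul h2).fderiv
      simp only [Pi.mul_def] at h3
      rw [h3]
      simp only [ContinuousLinearMap.add_apply, ContinuousLinearMap.smul_apply, smul_eq_mul]
      ring
    simp only [hder, Finset.sum_add_distrib, ← Finset.mul_sum]
    rw [grad_norm_sq, lap_eq_fderiv _ _ (hwa x hx)]
  · rw [indicator_of_notMem hx]
    symm
    refine Finset.sum_eq_zero fun i _ => ?_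
    rw [(hveq0 i x fun h => hx (hKO h)).fderiv_eq]
    simp

lemma lap_contOn {N : ℕ} {O : Set (EuclN N)} (hO : IsOpen O) {w : EuclN N → ℝ}
    (hw : ContDiffOn ℝ 2 w O) : ContinuousOn (lap w) O := by
  intro x hx
  have hwa := hw.contDiffAt (hO.mem_nhds hx)
  have h := hwa.continuousAt_iteratedFDeriv (k := 2) (by norm_num)
  refine ContinuousAt.continuousWithinAt ?_
  unfold lap
  refine tendsto_finset_sum _ fun i _ => ?_
  exact ((ContinuousMultilinearMap.apply ℝ (fun _ : Fin 2 => EuclN N) ℝ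
    ![EuclideanSpace.single i 1, EuclideanSpace.single i 1]).continuous.tendsto _).comp h

lemma grad_contOn {N : ℕ} {O : Set (EuclN N)} (hO : IsOpen O) {w : EuclN N → ℝ}
    (hw : ContDiffOn ℝ 2 w O) : ContinuousOn (gradient w) O := by
  have h := hw.continuousOn_fderiv_of_isOpen hO (by norm_num)
  exact (InnerProductSpace.toDual ℝ (EuclN N)).symm.continuous.comp_continuousOn h

lemma ibp_limit {N : ℕ} {O : Set (EuclN N)} (hO : IsOpen O) {w : EuclN N → ℝ}
    (hw : ContDiffOn ℝ 2 w O) (hK : ∀ ε > 0, IsCompact {x ∈ O | ε ≤ w x})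
    (hG : IntegrableOn (fun x => if 0 < w x then ‖gradient w x‖ ^ 2 else 0) O)
    (hL : IntegrableOn (fun x => max (w x) 0 * lap w x) O) :
    ∫ x in O, (if 0 < w x then ‖gradient w x‖ ^ 2 else 0) =
      - ∫ x in O, max (w x) 0 * lap w x := by
  rw [eq_neg_iff_add_eq_zero, ← integral_add hG hL]
  let s : ℕ → ℝ := fun n => 1 / ((n : ℝ) + 1)
  have hs0 : Tendsto s atTop (𝓝 0) := tendsto_one_div_add_atTop_nhds_zero_nat
  have hsp : ∀ n, 0 < s n := fun n => by positivity
  have hlim := tendsto_integral_of_dominated_convergence (μ := volume.restrict O)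
    (F := fun n x => phiD (s n) (w x) * ‖gradient w x‖ ^ 2 + phiT (s n) (w x) * lap w x)
    (f := fun x => (if 0 < w x then ‖gradient w x‖ ^ 2 else 0) + max (w x) 0 * lap w x)
    (fun x => (if 0 < w x then ‖gradient w x‖ ^ 2 else 0) + ‖max (w x) 0 * lap w x‖)
    ?_ (hG.add hL.norm) ?_ ?_
  · have : ∀ n, ∫ x in O, (phiD (s n) (w x) * ‖gradient w x‖ ^ 2
        + phiT (s n) (w x) * lap w x) = 0 := fun n => ibp_eps hO hw (hsp n) (hK _ (hsp n))
    simp only [this] at hlim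
    exact (tendsto_nhds_unique hlim tendsto_const_nhds)
  · intro n
    refine ContinuousOn.aestronglyMeasurable ?_ hO.measurableSet
    have h1 := (phiD_cont (hsp n)).comp_continuousOn hw.continuousOn
    have h2 := (phiT_contDiff (hsp n)).continuous.comp_continuousOn hw.continuousOn
    exact (h1.mul ((grad_contOn hO hw).norm.pow 2)).add (h2.mul (lap_contOn hO hw))
  · intro n
    refine Eventually.of_forall fun x => ?_
    refine (norm_add_le _ _).trans (add_le_add ?_ ?_)
    · rw [norm_mul, norm_pow, norm_norm, Real.norm_of_nonneg (phiD_nonneg _ _)]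
      split_ifs with h
      · exact mul_le_of_le_one_left (by positivity) (phiD_le _ _)
      · rw [phiD_zero (by linarith [hsp n]), zero_mul]
    · rw [norm_mul, norm_mul]
      gcongr
      rw [Real.norm_of_nonneg (phiT_nonneg _), Real.norm_of_nonneg (le_max_right _ _)]
      exact phiT_le (hsp n) _
  · refine Eventually.of_forall fun x => ?_
    refine Tendsto.add ?_ ((phiT_tendsto hs0 _).mul_const _)
    have := (phiD_tendsto hs0 hsp (w x)).mul_const (‖gradient w x‖ ^ 2)
    simpa [ite_mul] using this

lemma G_meas {N : ℕ} {O : Set (EuclN N)} (hO : IsOpen O) {w : EuclN N → ℝ}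
    (hw : ContDiffOn ℝ 2 w O) :
    AEStronglyMeasurable (fun x => if 0 < w x then ‖gradient w x‖ ^ 2 else 0)
      (volume.restrict O) := by
  let s : ℕ → ℝ := fun n => 1 / ((n : ℝ) + 1)
  have hs0 : Tendsto s atTop (𝓝 0) := tendsto_one_div_add_atTop_nhds_zero_nat
  have hsp : ∀ n, 0 < s n := fun n => by positivity
  refine aestronglyMeasurable_of_tendsto_ae atTop
    (f := fun n x => phiD (s n) (w x) * ‖gradient w x‖ ^ 2) ?_ ?_
  · intro n
    refine ContinuousOn.aestronglyMeasurable ?_ hO.measurableSet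
    have h1 := (phiD_cont (hsp n)).comp_continuousOn hw.continuousOn
    exact h1.mul ((grad_contOn hO hw).norm.pow 2)
  · refine Eventually.of_forall fun x => ?_
    have := (phiD_tendsto hs0 hsp (w x)).mul_const (‖gradient w x‖ ^ 2)
    simpa [ite_mul] using this

lemma dom_props {N : ℕ} {Ω : Set (EuclN N)} (hΩ : IsBallOrAnnulus Ω) :
    IsOpen Ω ∧ Bornology.IsBounded Ω ∧ ∀ x y : EuclN N, ‖x‖ = ‖y‖ → x ∈ Ω → y ∈ Ω := by
  rcases hΩ with ⟨R, hR, rfl⟩ | ⟨r, R, hr, hrR, rfl⟩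
  · refine ⟨Metric.isOpen_ball, Metric.isBounded_ball, fun x y h hx => ?_⟩
    simpa [← h] using hx
  · refine ⟨?_, ?_, fun x y h hx => ?_⟩
    · exact (isOpen_lt continuous_const continuous_norm).inter
        (isOpen_lt continuous_norm continuous_const)
    · refine (Metric.isBounded_ball (x := (0 : EuclN N)) (r := R)).subset fun x hx => ?_
      simpa using hx.2
    · simpa [← h] using hx

lemma refl_equiv {N : ℕ} {e : EuclN N} (he : ‖e‖ = 1) :
    ∃ g : EuclN N ≃ₗᵢ[ℝ] EuclN N, ∀ x, g x = reflPt e x := by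
  refine ⟨(Submodule.span ℝ {e})ᗮ.reflection, fun x => ?_⟩
  rw [Submodule.reflection_orthogonal_apply, Submodule.reflection_singleton_apply]
  simp only [he, reflPt, real_inner_comm x e]
  simp [← smul_assoc, two_smul, two_mul]

lemma refl_refl {N : ℕ} {e : EuclN N} (he : ‖e‖ = 1) (x : EuclN N) :
    reflPt e (reflPt e x) = x := by
  simp only [reflPt, inner_sub_left, real_inner_smul_left, real_inner_self_eq_norm_sq, he]
  module

lemma pd_cont {m : ℕ} {F : ℝ → (Fin m → ℝ) → ℝ}
    (hF : ContDiff ℝ 1 (fun q : ℝ × (Fin m → ℝ) => F q.1 q.2)) (j : Fin m) :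
    Continuous (fun q : ℝ × (Fin m → ℝ) => pd F j q.1 q.2) := by
  have h1 : ∀ q : ℝ × (Fin m → ℝ), pd F j q.1 q.2 =
      fderiv ℝ (fun q : ℝ × (Fin m → ℝ) => F q.1 q.2) q (0, Pi.single j 1) := by
    intro q
    have hd := (hF.differentiable (by norm_num) q).hasFDerivAt
    have h2 := HasFDerivAt.comp (f := fun s : Fin m → ℝ => (q.1, s)) q.2 hd
      (hasFDerivAt_prodMk_right (𝕜 := ℝ) q.1 q.2)
    have h3 : HasFDerivAt (F q.1) _ q.2 := h2
    unfold pd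
    rw [h3.fderiv]
    simp
  simp only [h1]
  exact (hF.continuous_fderiv (by norm_num)).clm_apply continuous_const

/-- **Nonpositivity of the linearized quadratic form on the positive part of the reflected
difference** (with the a.e. convention `∇w⁺ = ∇w · 1_{w>0}`). -/
theorem statement18
    {N m : ℕ} (hN : 2 ≤ N) (hm : 2 ≤ m)
    (Ω : Set (EuclN N)) (hΩ : IsBallOrAnnulus Ω)
    (f : Fin m → ℝ → (Fin m → ℝ) → ℝ)
    (hf : ∀ i, ContDiff ℝ 1 (fun q : ℝ × (Fin m → ℝ) => f i q.1 q.2))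
    (U : Fin m → EuclN N → ℝ)
    (hUreg : ∀ i, ContDiffOn ℝ 2 (U i) (closure Ω))
    (hsol : IsSolution Ω f U)
    (hcoup : ∀ e : EuclN N, ‖e‖ = 1 → FullyCoupledAlong f U (halfDom Ω e))
    (hmono : ∀ i j (r : ℝ) (s t : Fin m → ℝ), (∀ k, s k ≤ t k) →
      pd (f i) j r s ≤ pd (f i) j r t)
    (hdecomp : 3 ≤ m → ∀ i, ∃ g : Fin m → ℝ → ℝ → ℝ → ℝ,
      (∀ k, ContDiff ℝ 1 (fun q : ℝ × ℝ × ℝ => g k q.1 q.2.1 q.2.2)) ∧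
      ∀ (r : ℝ) (s : Fin m → ℝ), f i r s = ∑ k ∈ Finset.univ.erase i, g k r (s i) (s k)) :
    ∀ e : EuclN N, ‖e‖ = 1 →
      (∫ x in halfDom Ω e,
        ((∑ i, if U i (reflPt e x) < U i x then
            ‖gradient (fun y => U i y - U i (reflPt e y)) x‖ ^ 2 else 0) -
         ∑ i, ∑ j, pd (f i) j ‖x‖ (fun k => U k x) *
           max (U i x - U i (reflPt e x)) 0 * max (U j x - U j (reflPt e x)) 0)) ≤ 0 := by
  intro e he
  classical
  obtain ⟨hΩo, hΩb, hΩr⟩ := dom_props hΩ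
  have hcl : IsCompact (closure Ω) := hΩb.isCompact_closure
  obtain ⟨g, hg⟩ := refl_equiv he
  have hgg : ∀ x, reflPt e (reflPt e x) = x := refl_refl he
  have hgn : ∀ x, ‖reflPt e x‖ = ‖x‖ := fun x => by rw [← hg, g.norm_map]
  have hgc : Continuous (reflPt e) := by
    have : reflPt e = g := funext fun x => (hg x).symm
    rw [this]; exact g.continuous
  have hgΩ : ∀ x ∈ Ω, reflPt e x ∈ Ω := fun x hx => hΩr x _ (hgn x).symm hx
  have hgcl : ∀ x ∈ closure Ω, reflPt e x ∈ closure Ω := fun x hx =>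
    map_mem_closure hgc hx hgΩ
  set O := halfDom Ω e with hOdef
  have hOo : IsOpen O := by
    have h1 : IsOpen {x : EuclN N | (0:ℝ) < ⟪x, e⟫} :=
      isOpen_lt continuous_const (continuous_id.inner continuous_const)
    exact hΩo.inter h1
  have hOΩ : O ⊆ Ω := fun x hx => hx.1
  have hOcl : O ⊆ closure Ω := hOΩ.trans subset_closure
  let w : Fin m → EuclN N → ℝ := fun i x => U i x - U i (reflPt e x)
  have hUc : ∀ i, ContinuousOn (U i) (closure Ω) := fun i => (hUreg i).continuousOn
  have hUsc : ∀ i, ContinuousOn (fun x => U i (reflPt e x)) (closure Ω) := fun i =>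
    (hUc i).comp hgc.continuousOn hgcl
  have hwc : ∀ i, ContinuousOn (w i) (closure Ω) := fun i => (hUc i).sub (hUsc i)
  have hU2 : ∀ i, ∀ x ∈ Ω, ContDiffAt ℝ 2 (U i) x := fun i x hx =>
    (hUreg i).contDiffAt (mem_of_superset (hΩo.mem_nhds hx) subset_closure)
  have hUs2 : ∀ i, ∀ x ∈ Ω, ContDiffAt ℝ 2 (fun y => U i (reflPt e y)) x := by
    intro i x hx
    have h1 : ContDiffAt ℝ 2 (U i) (g x) := hU2 i _ (by rw [hg]; exact hgΩ x hx)
    have h2 := h1.comp x g.contDiff.contDiffAt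
    simpa [Function.comp_def, hg] using h2
  have hw2 : ∀ i, ContDiffOn ℝ 2 (w i) O := fun i x hx =>
    ((hU2 i x (hOΩ hx)).sub (hUs2 i x (hOΩ hx))).contDiffWithinAt
  have hlap : ∀ i, ∀ x ∈ O, lap (w i) x =
      -(f i ‖x‖ (fun k => U k x) - f i ‖x‖ (fun k => U k (reflPt e x))) := by
    intro i x hx
    have h0 : lap (fun y => U i (reflPt e y)) x = lap (U i) (reflPt e x) := by
      have := lap_comp g (U i) x
      simpa [hg] using this
    have h1 := hsol.1 i x (hOΩ hx)
    have h2 := hsol.1 i _ (hgΩ x (hOΩ hx))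
    rw [hgn] at h2
    have h3 : lap (w i) x = _ := lap_sub (hU2 i x (hOΩ hx)) (hUs2 i x (hOΩ hx))
    rw [h3, h0, ← h1, ← h2]; ring
  have hK : ∀ i, ∀ ε > 0, IsCompact {x ∈ O | ε ≤ w i x} := by
    intro i ε hε
    have hset : {x ∈ O | ε ≤ w i x} =
        {x ∈ closure Ω | ε ≤ w i x} ∩ {x | 0 ≤ ⟪x, e⟫} := by
      ext x
      constructor
      · rintro ⟨hx, h⟩
        exact ⟨⟨hOcl hx, h⟩, hx.2.le⟩
      · rintro ⟨⟨hx, h⟩, h0⟩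
        refine ⟨⟨?_, ?_⟩, h⟩
        · by_contra hn
          have e1 : U i x = 0 := hsol.2 i x (by rw [hΩo.frontier_eq]; exact ⟨hx, hn⟩)
          have e2 : U i (reflPt e x) = 0 := by
            refine hsol.2 i _ ?_
            rw [hΩo.frontier_eq]
            exact ⟨hgcl x hx, fun h => hn (by simpa [hgg] using hgΩ _ h)⟩
          simp only [w, e1, e2] at h
          linarith
        · refine lt_of_le_of_ne h0 fun h1 => ?_
          have : reflPt e x = x := by simp [reflPt, ← h1]
          simp only [w, this, sub_self] at h
          linarith
    rw [hset]
    refine IsCompact.inter_right ?_ (isClosed_le continuous_const (by fun_prop))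
    exact hcl.of_isClosed_subset
      ((hwc i).preimage_isClosed_of_isClosed isClosed_closure isClosed_Ici) fun x hx => hx.1
  have hfd : ∀ i r, Differentiable ℝ (f i r) := fun i r => by
    have := ((hf i).differentiable (by norm_num)).comp
      ((differentiable_const r).prodMk (differentiable_id (E := Fin m → ℝ)))
    exact this
  let P : EuclN N → ℝ := fun x => ∑ i, ∑ j, pd (f i) j ‖x‖ (fun k => U k x) *
           max (U i x - U i (reflPt e x)) 0 * max (U j x - U j (reflPt e x)) 0
  have hUv : ContinuousOn (fun x k => U k x) (closure Ω) := continuousOn_pi.2 hUc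
  have hUsv : ContinuousOn (fun x k => U k (reflPt e x)) (closure Ω) := continuousOn_pi.2 hUsc
  have hmax : ∀ i, ContinuousOn (fun x => max (w i x) 0) (closure Ω) := fun i =>
    (hwc i).sup continuousOn_const
  have hPc : ContinuousOn P (closure Ω) := by
    refine continuousOn_finset_sum _ fun i _ => continuousOn_finset_sum _ fun j _ => ?_
    refine ContinuousOn.mul (ContinuousOn.mul ?_ (hmax i)) (hmax j)
    exact (pd_cont (hf i) j).comp_continuousOn (continuous_norm.continuousOn.prodMk hUv)
  have hPi : IntegrableOn P O := (hPc.integrableOn_compact hcl).mono_set hOcl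
  let h : Fin m → EuclN N → ℝ := fun i x =>
    f i ‖x‖ (fun k => U k x) - f i ‖x‖ (fun k => U k (reflPt e x))
  have hhc : ∀ i, ContinuousOn (h i) (closure Ω) := fun i =>
    ((hf i).continuous.comp_continuousOn (continuous_norm.continuousOn.prodMk hUv)).sub
      ((hf i).continuous.comp_continuousOn (continuous_norm.continuousOn.prodMk hUsv))
  have hHi : ∀ i, IntegrableOn (fun x => h i x * max (w i x) 0) O := fun i =>
    (((hhc i).mul (hmax i)).integrableOn_compact hcl).mono_set hOcl
  let G : Fin m → EuclN N → ℝ := fun i x => if 0 < w i x then ‖gradient (w i) x‖ ^ 2 else 0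
  have hGeq : ∀ i x, (if U i (reflPt e x) < U i x then
      ‖gradient (fun y => U i y - U i (reflPt e y)) x‖ ^ 2 else 0) = G i x := by
    intro i x
    simp only [G, w, sub_pos]
  simp only [hGeq]
  change ∫ x in O, ((∑ i, G i x) - P x) ≤ 0
  by_cases hint : IntegrableOn (fun x => (∑ i, G i x) - P x) O
  swap
  · rw [integral_undef hint]
  have hGnn : ∀ i x, 0 ≤ G i x := fun i x => by
    simp only [G]; split_ifs <;> positivity
  have hS : IntegrableOn (fun x => ∑ i, G i x) O := by
    have := hint.add hPi
    refine this.congr (Eventually.of_forall fun x => ?_)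
    simp
  have hGi : ∀ i, IntegrableOn (G i) O := fun i => by
    refine Integrable.mono' hS (G_meas hOo (hw2 i)) (Eventually.of_forall fun x => ?_)
    rw [Real.norm_of_nonneg (hGnn i x)]
    exact Finset.single_le_sum (f := fun i => G i x) (fun j _ => hGnn j x) (Finset.mem_univ i)
  have hGH : ∀ i, ∫ x in O, G i x = ∫ x in O, h i x * max (w i x) 0 := by
    intro i
    have hpt : ∀ x ∈ O, max (w i x) 0 * lap (w i) x = -(h i x * max (w i x) 0) := by
      intro x hx
      rw [hlap i x hx]; simp only [h]; ring
    have hL : IntegrableOn (fun x => max (w i x) 0 * lap (w i) x) O :=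
      (integrableOn_congr_fun hpt hOo.measurableSet).2 (hHi i).neg
    have := ibp_limit hOo (hw2 i) (hK i) (hGi i) hL
    rw [setIntegral_congr_fun hOo.measurableSet hpt, integral_neg, neg_neg] at this
    exact this
  rw [integral_sub hS hPi, integral_finsetSum _ fun i _ => hGi i]
  simp only [hGH]
  rw [← integral_finsetSum _ fun i _ => hHi i, sub_nonpos]
  refine setIntegral_mono_on (integrable_finsetSum _ fun i _ => hHi i) hPi hOo.measurableSet ?_
  intro x hx
  refine Finset.sum_le_sum fun i _ => ?_
  exact pointwise_ineq (f i) ‖x‖ (hfd i _) i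
    (fun j hij s => (hcoup e he).1 i j hij x hx s) (fun j s t hst => hmono i j _ s t hst)
    (fun k => U k x) (fun k => U k (reflPt e x))
end
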